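/- If F is a family of subsets of [n] with n > r ≥ 2 and 1 ≤ t ≤ 2^r - r - 1, F is non-trivial (the intersection of all members of F is empty and the union of all members is [n]), and F is r-wise t-agreeing (any r sets F₁,...,F_r ∈ F agree on at least t coordinates, where they agree on x if x belongs to all of them or to none of them), then |F| ≤ (r+t+1)·2^(n-r-t). -/

import Mathlib

open Finset

/-- The set of coordinates on which the sets `f 0, ..., f (r-1)` all agree
(each coordinate is in all of them or in none of them). -/
def agreeSet {n r : ℕ} (f : Fin r → Finset (Fin n)) : Finset (Fin n) :=
  Finset.univ.filter (fun x => (∀ i, x ∈ f i) ∨ (∀ i, x ∉ f i))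

/-- `F` is `r`-wise `t`-agreeing: any `r` members of `F` agree on at least `t` coordinates. -/
def AgreeingFamily (n r t : ℕ) (F : Finset (Finset (Fin n))) : Prop :=
  ∀ f : Fin r → Finset (Fin n), (∀ i, f i ∈ F) → t ≤ (agreeSet f).card

/-- `F` is non-trivial: the intersection of all members is empty and their union is `[n]`. -/
def NonTrivialFamily (n : ℕ) (F : Finset (Finset (Fin n))) : Prop :=
  (∀ x : Fin n, ∃ A ∈ F, x ∉ A) ∧ (∀ x : Fin n, ∃ A ∈ F, x ∈ A)

lemma pair_bound {α : Type*} [DecidableEq α] (X : Finset α) (P Q : Finset (Finset α))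
    (hP : ∀ A ∈ P, A ⊆ X) (hQ : ∀ A ∈ Q, A ⊆ X)
    (h : ∀ A ∈ P, ∀ B ∈ Q, A ∪ B ≠ X) : P.card + Q.card ≤ 2 ^ X.card := by
  classical
  have hinj : Set.InjOn (fun A => X \ A) (P : Set (Finset α)) := by
    intro A hA B hB hAB
    have h1 := hP A hA
    have h2 := hP B hB
    simp only at hAB
    rw [← Finset.sdiff_sdiff_eq_self h1, hAB, Finset.sdiff_sdiff_eq_self h2]
  rw [← Finset.card_image_of_injOn hinj, ← Finset.card_powerset, ← Finset.card_union_of_disjoint]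
  · apply Finset.card_le_card
    intro A hA
    simp only [Finset.mem_union, Finset.mem_image] at hA
    rw [Finset.mem_powerset]
    rcases hA with ⟨B, hB, rfl⟩ | hA
    · exact Finset.sdiff_subset
    · exact hQ A hA
  · rw [Finset.disjoint_left]
    intro A hA hA2
    simp only [Finset.mem_image] at hA
    obtain ⟨B, hB, rfl⟩ := hA
    exact h B hB _ hA2 (Finset.union_sdiff_of_subset (hP B hB))

/-- down-closed and shifted family -/
structure SD (D : Finset (Finset ℕ)) : Prop where
  down : ∀ d ∈ D, ∀ e, e ⊆ d → e ∈ D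
  shift : ∀ d ∈ D, ∀ i j, j ∈ d → i < j → i ∉ d → insert i (d.erase j) ∈ D

def SubR (n : ℕ) (D : Finset (Finset ℕ)) : Prop := ∀ d ∈ D, d ⊆ Finset.range n

def Full1 (n : ℕ) (D : Finset (Finset ℕ)) : Prop := ∀ x < n, {x} ∈ D

def Full2 (n : ℕ) (D : Finset (Finset ℕ)) : Prop := ∀ x < n, ∀ y < n, {x, y} ∈ D

def res (m : ℕ) (D : Finset (Finset ℕ)) : Finset (Finset ℕ) :=
  (Finset.range m).powerset.filter (· ∈ D)

def slc (m : ℕ) (D : Finset (Finset ℕ)) : Finset (Finset ℕ) :=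
  (Finset.range m).powerset.filter (fun d => insert m d ∈ D)

lemma mem_res {m : ℕ} {D : Finset (Finset ℕ)} {d : Finset ℕ} :
    d ∈ res m D ↔ d ⊆ Finset.range m ∧ d ∈ D := by simp [res]

lemma mem_slc {m : ℕ} {D : Finset (Finset ℕ)} {d : Finset ℕ} :
    d ∈ slc m D ↔ d ⊆ Finset.range m ∧ insert m d ∈ D := by simp [slc]

lemma sub_res (m : ℕ) (D : Finset (Finset ℕ)) : SubR m (res m D) := fun _ hd => (mem_res.1 hd).1
lemma sub_slc (m : ℕ) (D : Finset (Finset ℕ)) : SubR m (slc m D) := fun _ hd => (mem_slc.1 hd).1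

lemma res_eq {m : ℕ} {D : Finset (Finset ℕ)} (h : SubR m D) : res m D = D := by
  ext d
  rw [mem_res]
  exact ⟨fun h => h.2, fun hd => ⟨h d hd, hd⟩⟩

lemma card_split (m : ℕ) (D : Finset (Finset ℕ)) :
    (res (m + 1) D).card = (res m D).card + (slc m D).card := by
  have hinj : Set.InjOn (fun d => insert m d) (slc m D : Set (Finset ℕ)) := by
    intro A hA B hB hAB
    have h1 : m ∉ A := fun h => by simpa using (mem_slc.1 hA).1 h
    have h2 : m ∉ B := fun h => by simpa using (mem_slc.1 hB).1 h
    simp only at hAB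
    rw [← Finset.erase_insert h1, hAB, Finset.erase_insert h2]
  rw [← Finset.card_image_of_injOn hinj, ← Finset.card_union_of_disjoint]
  · congr 1
    ext d
    simp only [Finset.mem_union, Finset.mem_image, mem_res, mem_slc]
    constructor
    · rintro ⟨h1, h2⟩
      by_cases hm : m ∈ d
      · right
        refine ⟨d.erase m, ⟨?_, ?_⟩, Finset.insert_erase hm⟩
        · intro x hx
          have := h1 (Finset.mem_of_mem_erase hx)
          have h3 := Finset.ne_of_mem_erase hx
          simp at this ⊢
          omega
        · rwa [Finset.insert_erase hm]
      · left
        refine ⟨?_, h2⟩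
        intro x hx
        have := h1 hx
        have h3 : x ≠ m := fun h => hm (h ▸ hx)
        simp at this ⊢
        omega
    · rintro (⟨h1, h2⟩ | ⟨e, ⟨h1, h2⟩, rfl⟩)
      · exact ⟨h1.trans (by simp), h2⟩
      · refine ⟨?_, h2⟩
        rw [Finset.range_add_one]
        exact Finset.insert_subset_insert _ h1
  · rw [Finset.disjoint_left]
    intro A hA hA2
    simp only [Finset.mem_image, mem_slc] at hA2
    obtain ⟨B, hB, rfl⟩ := hA2
    have := (mem_res.1 hA).1 (Finset.mem_insert_self m B)
    simp at this

lemma sd_res {D : Finset (Finset ℕ)} (h : SD D) (m : ℕ) : SD (res m D) := by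
  constructor
  · intro d hd e he
    rw [mem_res] at *
    exact ⟨he.trans hd.1, h.down d hd.2 e he⟩
  · intro d hd i j hj hij hi
    rw [mem_res] at *
    refine ⟨?_, h.shift d hd.2 i j hj hij hi⟩
    intro x hx
    have := hd.1 hj
    have h2 := @hd.1 x
    grind

lemma sd_slc {D : Finset (Finset ℕ)} (h : SD D) (m : ℕ) : SD (slc m D) := by
  constructor
  · intro d hd e he
    rw [mem_slc] at *
    exact ⟨he.trans hd.1, h.down _ hd.2 _ (Finset.insert_subset_insert _ he)⟩
  · intro d hd i j hj hij hi
    rw [mem_slc] at *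
    have hjm := hd.1 hj
    simp at hjm
    refine ⟨?_, ?_⟩
    · intro x hx
      have h2 := @hd.1 x
      grind
    · have := h.shift _ hd.2 i j (Finset.mem_insert_of_mem hj) hij (by
        rw [Finset.mem_insert]
        rintro (h | h)
        · omega
        · exact hi h)
      convert this using 1
      ext x
      simp only [Finset.mem_insert, Finset.mem_erase]
      have : m ≠ j := by omega
      grind

lemma slc_sub_res {D : Finset (Finset ℕ)} (h : SD D) (m : ℕ) : slc m D ⊆ res m D := by
  intro d hd
  rw [mem_slc] at hd
  rw [mem_res]
  exact ⟨hd.1, h.down _ hd.2 _ (Finset.subset_insert _ _)⟩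

lemma empty_mem {D : Finset (Finset ℕ)} (h : SD D) (hn : D.Nonempty) : ∅ ∈ D := by
  obtain ⟨d, hd⟩ := hn
  exact h.down d hd _ (Finset.empty_subset _)

lemma card_le_two_pow {n : ℕ} {D : Finset (Finset ℕ)} (h : SubR n D) : D.card ≤ 2 ^ n := by
  have : D ⊆ (Finset.range n).powerset := fun d hd => Finset.mem_powerset.2 (h d hd)
  simpa using Finset.card_le_card this

lemma full1_res {n : ℕ} {D : Finset (Finset ℕ)} (m : ℕ) (hm : m ≤ n) (h : Full1 n D) :
    Full1 m (res m D) := by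
  intro x hx
  rw [mem_res]
  exact ⟨by simpa using hx, h x (by omega)⟩

lemma full2_res {n : ℕ} {D : Finset (Finset ℕ)} (m k : ℕ) (hk : k ≤ n) (hm : k ≤ m)
    (h : Full2 n D) : Full2 k (res m D) := by
  intro x hx y hy
  rw [mem_res]
  refine ⟨?_, h x (by omega) y (by omega)⟩
  intro z hz
  simp at hz ⊢
  omega

lemma full1_slc {n : ℕ} {D : Finset (Finset ℕ)} (m : ℕ) (hm : m < n) (h : Full2 n D) :
    Full1 m (slc m D) := by
  intro x hx
  rw [mem_slc]
  exact ⟨by simpa using hx, h m (by omega) x (by omega)⟩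

lemma full1_of_full2 {n : ℕ} {D : Finset (Finset ℕ)} (h : Full2 n D) : Full1 n D := by
  intro x hx
  simpa using h x hx x hx

/-! ### cross families -/

def Cross (n s : ℕ) (P Q R : Finset (Finset ℕ)) : Prop :=
  ∀ A ∈ P, ∀ B ∈ Q, ∀ C ∈ R, (A ∪ B ∪ C).card + s ≤ n

lemma Cross.rotate {n s : ℕ} {P Q R : Finset (Finset ℕ)} (h : Cross n s P Q R) :
    Cross n s Q R P := by
  intro A hA B hB C hC
  have := h C hC A hA B hB
  rwa [Finset.union_assoc, Finset.union_comm] at this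

lemma Cross.swap {n s : ℕ} {P Q R : Finset (Finset ℕ)} (h : Cross n s P Q R) :
    Cross n s Q P R := by
  intro A hA B hB C hC
  have := h B hB A hA C hC
  rwa [Finset.union_comm B A] at this

lemma Cross.mono {n s s' : ℕ} {P Q R P' Q' R' : Finset (Finset ℕ)} (h : Cross n s P Q R)
    (hs : s' ≤ s) (hP : P' ⊆ P) (hQ : Q' ⊆ Q) (hR : R' ⊆ R) : Cross n s' P' Q' R' := by
  intro A hA B hB C hC
  have := h A (hP hA) B (hQ hB) C (hR hC)
  omega

/-- pair inequality -/
lemma cross_pair {n : ℕ} {P Q R : Finset (Finset ℕ)} (h : Cross n 1 P Q R) (hP : SubR n P)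
    (hQ : SubR n Q) (hR : ∅ ∈ R) : P.card + Q.card ≤ 2 ^ n := by
  have := pair_bound (Finset.range n) P Q hP hQ (by
    intro A hA B hB hAB
    have := h A hA B hB ∅ hR
    rw [hAB] at this
    simp at this)
  simpa using this

lemma cross_100 {n s : ℕ} {P Q R : Finset (Finset ℕ)} (h : Cross (n + 1) s P Q R) :
    Cross n s (slc n P) (res n Q) (res n R) := by
  intro A hA B hB C hC
  rw [mem_slc] at hA
  rw [mem_res] at hB hC
  have := h _ hA.2 _ hB.2 _ hC.2
  have h2 : insert n A ∪ B ∪ C = insert n (A ∪ B ∪ C) := by ext; simp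
  rw [h2, Finset.card_insert_of_notMem] at this
  · omega
  · intro h3
    simp only [Finset.mem_union] at h3
    rcases h3 with (h3 | h3) | h3
    · simpa using hA.1 h3
    · simpa using hB.1 h3
    · simpa using hC.1 h3

lemma cross_000 {n s : ℕ} {P Q R : Finset (Finset ℕ)} (h : Cross (n + 1) (s + 1) P Q R) :
    Cross n s (res n P) (res n Q) (res n R) := by
  intro A hA B hB C hC
  rw [mem_res] at hA hB hC
  have := h _ hA.2 _ hB.2 _ hC.2
  omega

lemma cross_110 {n : ℕ} {P Q R : Finset (Finset ℕ)} (h : Cross (n + 1) 1 P Q R) (hP : SD P) :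
    Cross n 2 (slc n P) (slc n Q) (res n R) := by
  intro A hA B hB C hC
  rw [mem_slc] at hA hB
  rw [mem_res] at hC
  by_contra hcon
  have hsub : A ∪ B ∪ C ⊆ Finset.range n :=
    Finset.union_subset (Finset.union_subset hA.1 hB.1) hC.1
  have hle := Finset.card_le_card hsub
  simp only [Finset.card_range] at hle
  have hmain : ∃ x, (x < n ∨ x = n) ∧ Finset.range (n + 1) ⊆ insert x A ∪ insert n B ∪ C ∧
      insert x A ∈ P := by
    have hc : (Finset.range n \ (A ∪ B ∪ C)).card ≤ 1 := by
      rw [Finset.card_sdiff_of_subset hsub, Finset.card_range]; omega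
    rcases Finset.eq_empty_or_nonempty (Finset.range n \ (A ∪ B ∪ C)) with h0 | ⟨x, hx⟩
    · refine ⟨n, Or.inr rfl, ?_, hA.2⟩
      intro y hy
      have : y ∉ Finset.range n \ (A ∪ B ∪ C) := by rw [h0]; simp
      grind
    · have hx' := hx
      simp only [Finset.mem_sdiff, Finset.mem_range, Finset.mem_union] at hx'
      refine ⟨x, Or.inl hx'.1, ?_, ?_⟩
      · intro y hy
        have hyx : y ∈ Finset.range n \ (A ∪ B ∪ C) → y = x :=
          fun h => Finset.card_le_one.1 hc y h x hx
        grind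
      · have hnA : n ∉ A := fun h => by simpa using hA.1 h
        have := hP.shift _ hA.2 x n (Finset.mem_insert_self _ _) hx'.1 (by simp; grind)
        rwa [Finset.erase_insert hnA] at this
  obtain ⟨x, hx, hcov, hmem⟩ := hmain
  have h1 := h _ hmem _ hB.2 _ hC.2
  have h2 := Finset.card_le_card hcov
  rw [Finset.card_range] at h2
  omega

lemma slc_nonempty {n : ℕ} {P : Finset (Finset ℕ)} (h : Full1 (n + 1) P) : ∅ ∈ slc n P := by
  rw [mem_slc]
  exact ⟨by simp, by simpa using h n (by omega)⟩

lemma res_empty_mem {n : ℕ} {P : Finset (Finset ℕ)} (h : ∅ ∈ P) : ∅ ∈ res n P := by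
  rw [mem_res]; exact ⟨by simp, h⟩

lemma cross_d0 (n : ℕ) : ∀ P Q R : Finset (Finset ℕ), SD P → SD Q → SD R → SubR n P → SubR n Q →
    SubR n R → ∅ ∈ P → ∅ ∈ Q → ∅ ∈ R → Cross n 2 P Q R →
    P.card + Q.card + R.card ≤ 2 ^ n := by
  induction n with
  | zero =>
    intro P Q R _ _ _ _ _ _ hP hQ hR h
    have := h _ hP _ hQ _ hR
    omega
  | succ n ih =>
    intro P Q R sP sQ sR uP uQ uR hP hQ hR h
    have cP := card_split n P
    have cQ := card_split n Q
    have cR := card_split n R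
    rw [res_eq uP] at cP
    rw [res_eq uQ] at cQ
    rw [res_eq uR] at cR
    have h0 := cross_000 h
    have bPQ := cross_pair h0 (sub_res _ _) (sub_res _ _) (res_empty_mem hR)
    have bQR := cross_pair h0.rotate (sub_res _ _) (sub_res _ _) (res_empty_mem hP)
    have bRP := cross_pair h0.rotate.rotate (sub_res _ _) (sub_res _ _) (res_empty_mem hQ)
    have iP : (slc n P).Nonempty → (slc n P).card + (res n Q).card + (res n R).card ≤ 2 ^ n :=
      fun hne => ih _ _ _ (sd_slc sP n) (sd_res sQ n) (sd_res sR n) (sub_slc _ _) (sub_res _ _)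
        (sub_res _ _) (empty_mem (sd_slc sP n) hne) (res_empty_mem hQ) (res_empty_mem hR)
        (cross_100 h)
    have iQ : (slc n Q).Nonempty → (slc n Q).card + (res n R).card + (res n P).card ≤ 2 ^ n :=
      fun hne => ih _ _ _ (sd_slc sQ n) (sd_res sR n) (sd_res sP n) (sub_slc _ _) (sub_res _ _)
        (sub_res _ _) (empty_mem (sd_slc sQ n) hne) (res_empty_mem hR) (res_empty_mem hP)
        (cross_100 h.rotate)
    have iR : (slc n R).Nonempty → (slc n R).card + (res n P).card + (res n Q).card ≤ 2 ^ n :=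
      fun hne => ih _ _ _ (sd_slc sR n) (sd_res sP n) (sd_res sQ n) (sub_slc _ _) (sub_res _ _)
        (sub_res _ _) (empty_mem (sd_slc sR n) hne) (res_empty_mem hP) (res_empty_mem hQ)
        (cross_100 h.rotate.rotate)
    have iall : (slc n P).Nonempty → (slc n Q).Nonempty → (slc n R).Nonempty →
        (slc n P).card + (slc n Q).card + (slc n R).card ≤ 2 ^ n :=
      fun h1 h2 h3 => ih _ _ _ (sd_slc sP n) (sd_slc sQ n) (sd_slc sR n) (sub_slc _ _)
        (sub_slc _ _) (sub_slc _ _) (empty_mem (sd_slc sP n) h1) (empty_mem (sd_slc sQ n) h2)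
        (empty_mem (sd_slc sR n) h3)
        ((cross_100 h).mono le_rfl subset_rfl (slc_sub_res sQ n) (slc_sub_res sR n))
    have lP := card_le_two_pow (sub_res n P)
    have lQ := card_le_two_pow (sub_res n Q)
    have lR := card_le_two_pow (sub_res n R)
    have e : 2 ^ (n + 1) = 2 * 2 ^ n := by ring
    rw [e]
    rcases (slc n P).eq_empty_or_nonempty with eP | eP <;>
    rcases (slc n Q).eq_empty_or_nonempty with eQ | eQ <;>
    rcases (slc n R).eq_empty_or_nonempty with eR | eR <;>
    simp only [eP, eQ, eR, Finset.not_nonempty_empty, Finset.card_empty, forall_true_left,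
      false_implies] at * <;> omega

/-- one full family: at most 5/4 -/
lemma cross_c1 (n : ℕ) : ∀ P Q R : Finset (Finset ℕ), SD P → SD Q → SD R → SubR n P → SubR n Q →
    SubR n R → Full1 n P → ∅ ∈ P → ∅ ∈ Q → ∅ ∈ R → Cross n 1 P Q R →
    4 * (P.card + Q.card + R.card) ≤ 5 * 2 ^ n := by
  induction n with
  | zero =>
    intro P Q R _ _ _ _ _ _ _ hP hQ hR h
    have := h _ hP _ hQ _ hR
    omega
  | succ n ih =>
    intro P Q R sP sQ sR uP uQ uR fP hP hQ hR h
    have cP := card_split n P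
    have cQ := card_split n Q
    have cR := card_split n R
    rw [res_eq uP] at cP
    rw [res_eq uQ] at cQ
    rw [res_eq uR] at cR
    have h1 := cross_100 h
    have nP := slc_nonempty fP
    have b1 := cross_pair h1 (sub_slc _ _) (sub_res _ _) (res_empty_mem hR)
    have b2 := cross_pair h1.rotate (sub_res _ _) (sub_res _ _) nP
    have b3 := cross_pair h1.rotate.rotate (sub_res _ _) (sub_slc _ _) (res_empty_mem hQ)
    have lP := card_le_two_pow (sub_res n P)
    have pQ : (slc n Q).card + (res n P).card ≤ 2 ^ n :=
      cross_pair (cross_100 h.rotate).rotate.rotate.swap (sub_slc _ _) (sub_res _ _)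
        (res_empty_mem hR)
    have pR : (slc n R).card + (res n P).card ≤ 2 ^ n :=
      cross_pair (cross_100 h.rotate.rotate) (sub_slc _ _) (sub_res _ _) (res_empty_mem hQ)
    have iQ : (slc n Q).Nonempty →
        4 * ((res n P).card + (slc n Q).card + (res n R).card) ≤ 5 * 2 ^ n :=
      fun hne => ih _ _ _ (sd_res sP n) (sd_slc sQ n) (sd_res sR n) (sub_res _ _) (sub_slc _ _)
        (sub_res _ _) (full1_res n (by omega) fP) (res_empty_mem hP) (empty_mem (sd_slc sQ n) hne)
        (res_empty_mem hR) (cross_100 h.rotate).rotate.rotate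
    have iR : (slc n R).Nonempty →
        4 * ((res n P).card + (res n Q).card + (slc n R).card) ≤ 5 * 2 ^ n :=
      fun hne => ih _ _ _ (sd_res sP n) (sd_res sQ n) (sd_slc sR n) (sub_res _ _) (sub_res _ _)
        (sub_slc _ _) (full1_res n (by omega) fP) (res_empty_mem hP) (res_empty_mem hQ)
        (empty_mem (sd_slc sR n) hne) (cross_100 h.rotate.rotate).rotate
    have iall : (slc n Q).Nonempty → (slc n R).Nonempty →
        (slc n P).card + (slc n Q).card + (slc n R).card ≤ 2 ^ n :=
      fun h2 h3 => cross_d0 n _ _ _ (sd_slc sP n) (sd_slc sQ n) (sd_slc sR n) (sub_slc _ _)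
        (sub_slc _ _) (sub_slc _ _) nP (empty_mem (sd_slc sQ n) h2)
        (empty_mem (sd_slc sR n) h3)
        ((cross_110 h sP).mono le_rfl subset_rfl subset_rfl (slc_sub_res sR n))
    have e : 2 ^ (n + 1) = 2 * 2 ^ n := by ring
    rw [e]
    rcases (slc n Q).eq_empty_or_nonempty with eQ | eQ <;>
    rcases (slc n R).eq_empty_or_nonempty with eR | eR <;>
    simp only [eQ, eR, Finset.not_nonempty_empty, Finset.card_empty, forall_true_left,
      false_implies] at * <;> omega

/-- two full families: at most 9/8 -/
lemma cross_c2 (n : ℕ) : ∀ P Q R : Finset (Finset ℕ), SD P → SD Q → SD R → SubR n P → SubR n Q →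
    SubR n R → Full1 n P → Full1 n R → ∅ ∈ P → ∅ ∈ Q → ∅ ∈ R → Cross n 1 P Q R →
    8 * (P.card + Q.card + R.card) ≤ 9 * 2 ^ n := by
  induction n with
  | zero =>
    intro P Q R _ _ _ _ _ _ _ _ hP hQ hR h
    have := h _ hP _ hQ _ hR
    omega
  | succ n ih =>
    intro P Q R sP sQ sR uP uQ uR fP fR hP hQ hR h
    have cP := card_split n P
    have cQ := card_split n Q
    have cR := card_split n R
    rw [res_eq uP] at cP
    rw [res_eq uQ] at cQ
    rw [res_eq uR] at cR
    have nP := slc_nonempty fP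
    have nR := slc_nonempty fR
    have b1 : 4 * ((res n R).card + (slc n P).card + (res n Q).card) ≤ 5 * 2 ^ n :=
      cross_c1 n _ _ _ (sd_res sR n) (sd_slc sP n) (sd_res sQ n) (sub_res _ _) (sub_slc _ _)
        (sub_res _ _) (full1_res n (by omega) fR) (res_empty_mem hR) nP (res_empty_mem hQ)
        (cross_100 h).rotate.rotate
    have b2 : 4 * ((res n P).card + (res n Q).card + (slc n R).card) ≤ 5 * 2 ^ n :=
      cross_c1 n _ _ _ (sd_res sP n) (sd_res sQ n) (sd_slc sR n) (sub_res _ _) (sub_res _ _)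
        (sub_slc _ _) (full1_res n (by omega) fP) (res_empty_mem hP) (res_empty_mem hQ) nR
        (cross_100 h.rotate.rotate).rotate
    have b3 : (slc n R).card + (res n P).card ≤ 2 ^ n :=
      cross_pair (cross_100 h.rotate.rotate) (sub_slc _ _) (sub_res _ _) (res_empty_mem hQ)
    have iQ : (slc n Q).Nonempty →
        8 * ((res n P).card + (slc n Q).card + (res n R).card) ≤ 9 * 2 ^ n :=
      fun hne => ih _ _ _ (sd_res sP n) (sd_slc sQ n) (sd_res sR n) (sub_res _ _) (sub_slc _ _)
        (sub_res _ _) (full1_res n (by omega) fP) (full1_res n (by omega) fR)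
        (res_empty_mem hP) (empty_mem (sd_slc sQ n) hne)
        (res_empty_mem hR) (cross_100 h.rotate).rotate.rotate
    have d1 : (slc n Q).Nonempty →
        (slc n P).card + (slc n Q).card + (res n R).card ≤ 2 ^ n :=
      fun h2 => cross_d0 n _ _ _ (sd_slc sP n) (sd_slc sQ n) (sd_res sR n) (sub_slc _ _)
        (sub_slc _ _) (sub_res _ _) nP (empty_mem (sd_slc sQ n) h2) (res_empty_mem hR)
        (cross_110 h sP)
    have d2 : (slc n Q).Nonempty →
        (slc n Q).card + (slc n R).card + (res n P).card ≤ 2 ^ n :=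
      fun h2 => cross_d0 n _ _ _ (sd_slc sQ n) (sd_slc sR n) (sd_res sP n) (sub_slc _ _)
        (sub_slc _ _) (sub_res _ _) (empty_mem (sd_slc sQ n) h2) nR (res_empty_mem hP)
        (cross_110 h.rotate sQ)
    have d3 : (slc n R).card + (slc n P).card + (res n Q).card ≤ 2 ^ n :=
      cross_d0 n _ _ _ (sd_slc sR n) (sd_slc sP n) (sd_res sQ n) (sub_slc _ _)
        (sub_slc _ _) (sub_res _ _) nR nP (res_empty_mem hQ)
        (cross_110 h.rotate.rotate sR)
    have e : 2 ^ (n + 1) = 2 * 2 ^ n := by ring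
    rw [e]
    rcases (slc n Q).eq_empty_or_nonempty with eQ | eQ <;>
    simp only [eQ, Finset.not_nonempty_empty, Finset.card_empty, forall_true_left,
      false_implies] at * <;> omega

structure Good (n r t : ℕ) (D : Finset (Finset ℕ)) : Prop where
  sd : SD D
  sub : SubR n D
  un : ∀ f : Fin r → Finset ℕ, (∀ i, f i ∈ D) → (Finset.univ.biUnion f).card + t ≤ n

lemma good_res_add {m a r s : ℕ} {D : Finset (Finset ℕ)} (h : Good (m + a) r (s + a) D) :
    Good m r s (res m D) := by
  refine ⟨sd_res h.sd m, sub_res _ _, ?_⟩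
  intro f hf
  have := h.un f (fun i => (mem_res.1 (hf i)).2)
  omega

lemma good_of_sub {m a r s : ℕ} {D : Finset (Finset ℕ)} (h : Good (m + a) r (s + a) D)
    (hs : SubR m D) : Good m r s D := by
  have := good_res_add h
  rwa [res_eq hs] at this

lemma good_le {n r t : ℕ} {D : Finset (Finset ℕ)} (h : Good n r t D) (hD : D.Nonempty) :
    t ≤ n := by
  have := h.un (fun _ => ∅) (fun _ => empty_mem h.sd hD)
  omega

lemma good_mono {n r t t' : ℕ} {D : Finset (Finset ℕ)} (h : Good n r t D) (ht : t' ≤ t) :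
    Good n r t' D := by
  refine ⟨h.sd, h.sub, ?_⟩
  intro f hf
  have := h.un f hf
  omega

lemma good_slc {n r t s : ℕ} {D : Finset (Finset ℕ)} (h : Good (n + 1) r t D) (ht : 1 ≤ t)
    (hr : 1 ≤ r) (hs : s + 1 = t + r) : Good n r s (slc n D) := by
  refine ⟨sd_slc h.sd n, sub_slc _ _, ?_⟩
  intro f hf
  set U := Finset.univ.biUnion f with hU
  have hUn : U ⊆ Finset.range n := by
    rw [hU, Finset.biUnion_subset]
    exact fun i _ => (mem_slc.1 (hf i)).1
  have hnU : n ∉ U := fun h => by simpa using hUn h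
  have hM : (Finset.range n \ U).card = n - U.card := by
    rw [Finset.card_sdiff_of_subset hUn, Finset.card_range]
  have hUle : U.card ≤ n := by simpa using Finset.card_le_card hUn
  obtain ⟨M, hMsub, hMc⟩ := Finset.exists_subset_card_eq
    (s := Finset.range n \ U) (n := min (n - U.card) (r - 1)) (by rw [hM]; exact min_le_left _ _)
  set q := min (n - U.card) (r - 1) with hq
  have hqr : q ≤ r - 1 := min_le_right _ _
  let e : Fin q ≃ M := (M.equivFinOfCardEq hMc).symm
  let g : Fin r → Finset ℕ := fun k =>
    if hk : k.val < q then insert (e ⟨k.val, hk⟩ : ℕ) (f k) else insert n (f k)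
  have hg : ∀ k, g k ∈ D := by
    intro k
    have hk := mem_slc.1 (hf k)
    by_cases hkq : k.val < q
    · simp only [g, hkq, dif_pos]
      have hx := hMsub (e ⟨k.val, hkq⟩).2
      rw [Finset.mem_sdiff, Finset.mem_range] at hx
      have hxk : (e ⟨k.val, hkq⟩ : ℕ) ∉ f k := fun h =>
        hx.2 (Finset.mem_biUnion.2 ⟨k, Finset.mem_univ _, h⟩)
      have hnk : n ∉ f k := fun h => by simpa using hk.1 h
      have := h.sd.shift _ hk.2 (e ⟨k.val, hkq⟩ : ℕ) n (Finset.mem_insert_self _ _) hx.1 (by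
        rw [Finset.mem_insert]
        rintro (h | h)
        · omega
        · exact hxk h)
      rwa [Finset.erase_insert hnk] at this
    · simp only [g, hkq, dif_neg, not_false_iff]
      exact hk.2
  have hun := h.un g hg
  have hsub : insert n (U ∪ M) ⊆ Finset.univ.biUnion g := by
    intro x hx
    rw [Finset.mem_insert, Finset.mem_union] at hx
    rw [Finset.mem_biUnion]
    rcases hx with rfl | hx | hx
    · refine ⟨⟨r - 1, by omega⟩, Finset.mem_univ _, ?_⟩
      have : ¬ (r - 1 < q) := by omega
      simp [g, this]
    · obtain ⟨k, _, hk⟩ := Finset.mem_biUnion.1 hx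
      refine ⟨k, Finset.mem_univ _, ?_⟩
      by_cases hkq : k.val < q <;> simp [g, hkq, hk]
    · refine ⟨⟨(e.symm ⟨x, hx⟩).val, by have := (e.symm ⟨x, hx⟩).2; omega⟩, Finset.mem_univ _, ?_⟩
      have h3 := (e.symm ⟨x, hx⟩).2
      simp only [g, h3, dif_pos, Fin.eta, Equiv.apply_symm_apply]
      exact Finset.mem_insert_self _ _
  have hdis : Disjoint U M := by
    rw [Finset.disjoint_left]
    intro x hx hxM
    exact (Finset.mem_sdiff.1 (hMsub hxM)).2 hx
  have hnM : n ∉ U ∪ M := by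
    rw [Finset.mem_union]
    rintro (h | h)
    · exact hnU h
    · simpa using (Finset.mem_sdiff.1 (hMsub h)).1
  have hc := Finset.card_le_card hsub
  rw [Finset.card_insert_of_notMem hnM, Finset.card_union_of_disjoint hdis, hMc] at hc
  rcases le_total (n - U.card) (r - 1) with h1 | h1
  · have : q = n - U.card := min_eq_left h1
    omega
  · have : q = r - 1 := min_eq_right h1
    omega

lemma good_res_full {n r : ℕ} {D : Finset (Finset ℕ)} (h : Good (n + 1) (r + 1) 1 D)
    (hn : {n} ∈ D) : Good n r 1 (res n D) := by
  refine ⟨sd_res h.sd n, sub_res _ _, ?_⟩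
  intro f hf
  have := h.un (Fin.cons {n} f) (by
    intro i
    refine Fin.cases ?_ ?_ i
    · simpa using hn
    · intro i
      simpa using (mem_res.1 (hf i)).2)
  have h2 : insert n (Finset.univ.biUnion f) ⊆
      Finset.univ.biUnion (Fin.cons {n} f : Fin (r + 1) → Finset ℕ) := by
    intro x hx
    rw [Finset.mem_biUnion]
    rcases Finset.mem_insert.1 hx with rfl | hx
    · exact ⟨0, Finset.mem_univ _, by simp⟩
    · obtain ⟨k, _, hk⟩ := Finset.mem_biUnion.1 hx
      exact ⟨k.succ, Finset.mem_univ _, by simpa using hk⟩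
  have h3 : n ∉ Finset.univ.biUnion f := by
    intro h
    obtain ⟨k, _, hk⟩ := Finset.mem_biUnion.1 h
    simpa using (mem_res.1 (hf k)).1 hk
  have h4 := Finset.card_le_card h2
  rw [Finset.card_insert_of_notMem h3] at h4
  omega

def A1 (n : ℕ) : Prop := ∀ (r t : ℕ) (D : Finset (Finset ℕ)), 2 ≤ r → 1 ≤ t → t + r + 1 ≤ 2 ^ r →
  Good n r t D → Full1 n D → (D.card : ℚ) * 2 ^ (r + t) ≤ (r + t + 1) * 2 ^ n

lemma sd_single {n x : ℕ} {D : Finset (Finset ℕ)} (h : SD D) (hx : {x} ∉ D) (hxn : x ≤ n)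
    (d : Finset ℕ) (hd : d ∈ D) : n ∉ d := by
  intro hn
  have h1 : {n} ∈ D := h.down d hd _ (by simpa using hn)
  rcases hxn.eq_or_lt with h2 | h2
  · exact hx (h2 ▸ h1)
  · have := h.shift _ h1 x n (by simp) h2 (by simp; omega)
    simp at this
    exact hx this

lemma sub_pred {n : ℕ} {D : Finset (Finset ℕ)} (h : SubR (n + 1) D) (hn : ∀ d ∈ D, n ∉ d) :
    SubR n D := by
  intro d hd x hx
  have h1 := h d hd hx
  have h2 : x ≠ n := fun h => hn d hd (h ▸ hx)
  simp at h1 ⊢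
  omega

lemma a2 {N : ℕ} (hA : ∀ m ≤ N, A1 m) : ∀ n ≤ N, ∀ (r t : ℕ) (D : Finset (Finset ℕ)), 2 ≤ r →
    t + r + 1 ≤ 2 ^ r → Good n r t D → (D.card : ℚ) * 2 ^ t ≤ 2 ^ n := by
  intro n
  induction n with
  | zero =>
    intro _ r t D _ _ hg
    rcases D.eq_empty_or_nonempty with rfl | hD
    · simp
    · have := good_le hg hD
      obtain rfl : t = 0 := by omega
      have := card_le_two_pow hg.sub
      simp at this ⊢
      exact this
  | succ n ih =>
    intro hn r t D hr ht hg
    rcases Nat.eq_zero_or_pos t with rfl | ht1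
    · have := card_le_two_pow hg.sub
      have h2 : (D.card : ℚ) ≤ 2 ^ (n + 1) := by exact_mod_cast this
      simpa using h2
    by_cases hf : Full1 (n + 1) D
    · have h1 := hA (n + 1) hn r t D hr ht1 ht hg hf
      have h2 : ((t : ℚ) + r + 1) ≤ 2 ^ r := by exact_mod_cast ht
      have h3 : (0 : ℚ) < 2 ^ r := by positivity
      have h4 : (0 : ℚ) < 2 ^ (n + 1) := by positivity
      rw [pow_add] at h1
      have h5 : ((r : ℚ) + t + 1) * 2 ^ (n + 1) ≤ 2 ^ r * 2 ^ (n + 1) := by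
        apply mul_le_mul_of_nonneg_right _ h4.le
        linarith
      have h6 : (2 : ℚ) ^ r * (D.card * 2 ^ t) ≤ 2 ^ r * 2 ^ (n + 1) := by
        calc _ = (D.card : ℚ) * (2 ^ r * 2 ^ t) := by ring
          _ ≤ _ := h1.trans h5
      exact le_of_mul_le_mul_left h6 h3
    · unfold Full1 at hf
      push Not at hf
      obtain ⟨x, hx, hxD⟩ := hf
      have hs : SubR n D := sub_pred hg.sub (sd_single hg.sd hxD (by omega))
      obtain ⟨t, rfl⟩ : ∃ k, t = k + 1 := ⟨t - 1, by omega⟩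
      have := ih (by omega) r t D hr (by omega) (good_of_sub (a := 1) hg hs)
      rw [pow_succ, pow_succ]
      linarith

lemma bB {N : ℕ} (hA : ∀ m ≤ N, A1 m) (r s : ℕ) (β : ℚ) (hr : 2 ≤ r) (hs : s + r + 1 ≤ 2 ^ r)
    (hs1 : 1 ≤ s) (hβ1 : 1 ≤ β) (hβ : 1 + (β / 2) ^ r ≤ β) :
    ∀ n ≤ N, ∀ (a : ℕ) (D : Finset (Finset ℕ)), Good n r (s + a) D →
    (D.card : ℚ) * 2 ^ (s + a) ≤ β ^ a * 2 ^ n := by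
  intro n
  induction n with
  | zero =>
    intro _ a D hg
    rcases D.eq_empty_or_nonempty with rfl | hD
    · simp only [Finset.card_empty]
      push_cast
      rw [zero_mul]
      positivity
    · have := good_le hg hD
      omega
  | succ n ih =>
    intro hn a D hg
    rcases Nat.eq_zero_or_pos a with rfl | ha
    · have := a2 hA (n + 1) hn r s D hr hs hg
      simpa using this
    obtain ⟨a, rfl⟩ : ∃ k, a = k + 1 := ⟨a - 1, by omega⟩
    have h0 := ih (by omega) a (res n D) (good_res_add (a := 1) hg)
    have h1 := ih (by omega) (a + r) (slc n D) (good_slc hg (by omega) (by omega) (by omega))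
    have hc := card_split n D
    rw [res_eq hg.sub] at hc
    rw [hc]
    push_cast
    have e1 : (slc n D).card * (2 : ℚ) ^ (s + (a + r)) =
      2 ^ r * ((slc n D).card * 2 ^ (s + a)) := by ring
    rw [e1] at h1
    have e2 : (2 : ℚ) ^ r * ((slc n D).card * 2 ^ (s + a)) ≤
        2 ^ r * (β ^ a * (β / 2) ^ r * 2 ^ n) := by
      refine h1.trans (le_of_eq ?_)
      rw [div_pow]
      field_simp
      ring
    have h2 := le_of_mul_le_mul_left e2 (by positivity)
    have h3 : β ^ a * 2 ^ n * (1 + (β / 2) ^ r) ≤ β ^ a * 2 ^ n * β :=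
      mul_le_mul_of_nonneg_left hβ (by positivity)
    have e3 : (((res n D).card : ℚ) + (slc n D).card) * 2 ^ (s + (a + 1)) =
      2 * ((res n D).card * 2 ^ (s + a) + (slc n D).card * 2 ^ (s + a)) := by ring
    have e4 : β ^ (a + 1) * 2 ^ (n + 1) = 2 * (β ^ a * 2 ^ n * β) := by ring
    rw [e3, e4]
    linarith

def B2 (r K : ℕ) : ℚ := (r + 2) + (((K : ℚ) - 1) * (K + 2) / 2 + 2 * r * (K - 1)) / 2 ^ r

lemma h2 {N : ℕ} (hA : ∀ m ≤ N, A1 m) (r : ℕ) (hr : 2 ≤ r) (K : ℕ) (hK : 1 ≤ K) :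
    ∀ (n : ℕ) (D : Finset (Finset ℕ)), n ≤ N →
    K + 2 * r ≤ 2 ^ r → Good n r K D → Full2 n D →
    (D.card : ℚ) * 2 ^ (r + K) ≤ B2 r K * 2 ^ n := by
  induction K, hK using Nat.le_induction with
  | base =>
    intro n D hn hK hg hf
    have := hA n hn r 1 D hr le_rfl (by omega) hg (full1_of_full2 hf)
    refine this.trans (le_of_eq ?_)
    simp [B2]
    ring
  | succ K hK ih =>
    intro n D hn hKr hg hf
    have hpos : 0 ≤ B2 r (K + 1) := by
      unfold B2
      push_cast
      have : ((K : ℚ) + 1 - 1) = K := by ring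
      rw [this]
      positivity
    rcases n with _ | n
    · rcases D.eq_empty_or_nonempty with rfl | hD
      · simp only [Finset.card_empty]
        push_cast
        rw [zero_mul]
        positivity
      · have := good_le hg hD
        omega
    have h0 := ih n (res n D) (by omega) (by omega) (good_res_add (a := 1) hg)
      (full2_res n n (by omega) le_rfl hf)
    have h1 := hA n (by omega) r (K + r) (slc n D) hr (by omega) (by omega)
      (good_slc hg (by omega) (by omega) (by omega)) (full1_slc n (by omega) hf)
    have hc := card_split n D
    rw [res_eq hg.sub] at hc
    rw [hc]
    push_cast at h1 ⊢
    have e1 : (slc n D).card * (2 : ℚ) ^ (r + (K + r)) =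
      2 ^ r * ((slc n D).card * 2 ^ (r + K)) := by ring
    rw [e1] at h1
    have e2 : (2 : ℚ) ^ r * ((slc n D).card * 2 ^ (r + K)) ≤
        2 ^ r * ((K + 1 + 2 * r) / 2 ^ r * 2 ^ n) := by
      refine h1.trans (le_of_eq ?_)
      field_simp
      ring
    have h2 := le_of_mul_le_mul_left e2 (by positivity)
    have hB : B2 r (K + 1) = B2 r K + (K + 1 + 2 * r) / 2 ^ r := by
      unfold B2
      push_cast
      field_simp
      ring
    rw [hB]
    have e3 : (((res n D).card : ℚ) + (slc n D).card) * 2 ^ (r + (K + 1)) =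
      2 * ((res n D).card * 2 ^ (r + K) + (slc n D).card * 2 ^ (r + K)) := by ring
    have e4 : (B2 r K + (K + 1 + 2 * r) / 2 ^ r) * 2 ^ (n + 1) =
      2 * (B2 r K * 2 ^ n + (K + 1 + 2 * r) / 2 ^ r * 2 ^ n) := by ring
    rw [e3, e4]
    linarith

lemma tT {N : ℕ} (hA : ∀ m ≤ N, A1 m) (r s L : ℕ) (β : ℚ) (hr : 2 ≤ r) (hs : s + r + 1 = 2 ^ r)
    (hL : L + r = s + 1) (hL1 : 1 ≤ L)
    (hs1 : 1 ≤ s) (hβ1 : 1 ≤ β) (hβ : 1 + (β / 2) ^ r ≤ β) (a : ℕ) :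
    ∀ (m : ℕ) (D : Finset (Finset ℕ)), m ≤ N → m + a ≤ N + 1 → Good (m + a) r (L + a) D →
    Full2 m D →
    (D.card : ℚ) * 2 ^ (r + L + a) ≤ (B2 r L + ∑ i ∈ Finset.range a, β ^ (i + 1)) * 2 ^ (m + a) := by
  induction a with
  | zero =>
    intro m D hm _ hg hf
    have := h2 hA r hr L hL1 m D hm (by omega) hg hf
    simpa using this
  | succ a ih =>
    intro m D hm hma hg hf
    have h0 := ih m (res (m + a) D) hm (by omega) (good_res_add (a := 1) hg)
      (full2_res (m + a) m (by omega) (by omega) hf)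
    have h1 := bB hA r s β hr (by omega) hs1 hβ1 hβ (m + a) (by omega) (a + 1) (slc (m + a) D)
      (good_slc (t := L + (a + 1)) hg (by omega) (by omega) (by omega))
    have hc := card_split (m + a) D
    rw [res_eq (show SubR (m + a + 1) D from hg.sub)] at hc
    rw [hc]
    push_cast
    have e0 : s + (a + 1) = r + L + a := by omega
    rw [e0] at h1
    rw [Finset.sum_range_succ]
    have e3 : (((res (m + a) D).card : ℚ) + (slc (m + a) D).card) * 2 ^ (r + L + (a + 1)) =
      2 * ((res (m + a) D).card * 2 ^ (r + L + a) + (slc (m + a) D).card * 2 ^ (r + L + a)) := by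
      ring
    have e4 : (B2 r L + (∑ i ∈ Finset.range a, β ^ (i + 1) + β ^ (a + 1))) * 2 ^ (m + (a + 1)) =
      2 * ((B2 r L + ∑ i ∈ Finset.range a, β ^ (i + 1)) * 2 ^ (m + a) +
        β ^ (a + 1) * 2 ^ (m + a)) := by ring
    rw [e3, e4]
    linarith

lemma num_pow (r : ℕ) (hr : 5 ≤ r) : 16 * (9 / 8 : ℚ) ^ r + 2 * r ≤ 2 ^ r + 13 ∧ (32 : ℚ) ≤ 2 ^ r := by
  induction r, hr using Nat.le_induction with
  | base => norm_num
  | succ r hr ih =>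
    obtain ⟨h1, h2⟩ := ih
    have h3 : (0 : ℚ) ≤ r := by positivity
    rw [pow_succ, pow_succ]
    push_cast
    constructor <;> linarith

lemma sum_beta (a : ℕ) : ∑ i ∈ Finset.range a, (9 / 8 : ℚ) ^ (i + 1) = 9 * (9 / 8) ^ a - 9 := by
  induction a with
  | zero => simp
  | succ a ih =>
    rw [Finset.sum_range_succ, ih]
    ring

lemma sum_beta_mono (a b : ℕ) (h : a ≤ b) : 9 * (9 / 8 : ℚ) ^ a - a ≤ 9 * (9 / 8 : ℚ) ^ b - b := by
  induction b, h using Nat.le_induction with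
  | base => exact le_rfl
  | succ b hb ih =>
    refine ih.trans ?_
    have : (1 : ℚ) ≤ (9 / 8) ^ b := one_le_pow₀ (by norm_num)
    rw [pow_succ]
    push_cast
    linarith

lemma num_final (r L a : ℕ) (hr : 4 ≤ r) (hL : L + 2 * r = 2 ^ r) (ha : a + 1 ≤ r) :
    B2 r L + ∑ i ∈ Finset.range a, (9 / 8 : ℚ) ^ (i + 1) ≤ r + (L + a) + 1 := by
  rw [sum_beta]
  obtain ⟨b, rfl⟩ : ∃ b, r = b + 1 := ⟨r - 1, by omega⟩
  have h1 := sum_beta_mono a b (by omega)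
  have hq : (0 : ℚ) < 2 ^ (b + 1) := by positivity
  have hLq : (L : ℚ) = 2 ^ (b + 1) - 2 * (b + 1) := by
    have : ((L + 2 * (b + 1) : ℕ) : ℚ) = (2 ^ (b + 1) : ℕ) := by rw [hL]
    push_cast at this
    linarith
  have key : 9 * (9 / 8 : ℚ) ^ b - b - 9 ≤
      ((2 : ℚ) ^ (b + 1) - 2 * (b + 1) - 1) * ((2 : ℚ) ^ (b + 1) - 2 * (b + 1) - 2)
        / (2 * 2 ^ (b + 1)) := by
    rcases (show b + 1 = 4 ∨ 5 ≤ b + 1 by omega) with h | h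
    · obtain rfl : b = 3 := by omega
      norm_num
    · obtain ⟨h2, h3⟩ := num_pow (b + 1) h
      rw [pow_succ (9 / 8 : ℚ)] at h2
      push_cast at h2
      rw [le_div_iff₀ (by positivity)]
      have h4 : (0 : ℚ) ≤ b := by positivity
      have h5 : 2 * (9 * (9 / 8 : ℚ) ^ b - b - 9) ≤ 2 ^ (b + 1) - 4 * (b + 1) - 3 := by linarith
      have h6 := mul_le_mul_of_nonneg_right h5 hq.le
      nlinarith
  have e : B2 (b + 1) L = (b + 1) + L + 1 -
      ((2 : ℚ) ^ (b + 1) - 2 * (b + 1) - 1) * ((2 : ℚ) ^ (b + 1) - 2 * (b + 1) - 2)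
        / (2 * 2 ^ (b + 1)) := by
    unfold B2
    rw [hLq]
    generalize (2 : ℚ) ^ (b + 1) = q at *
    push_cast
    field_simp
    ring
  rw [e]
  push_cast
  linarith

lemma beta_ok (r : ℕ) (hr : 4 ≤ r) : 1 + ((9 / 8 : ℚ) / 2) ^ r ≤ 9 / 8 := by
  have : ((9 / 8 : ℚ) / 2) ^ r ≤ ((9 / 8 : ℚ) / 2) ^ 4 :=
    pow_le_pow_of_le_one (by norm_num) (by norm_num) hr
  norm_num at this ⊢
  linarith

lemma sd_pair {D : Finset (Finset ℕ)} (h : SD D) {x y z w : ℕ} (hzw : z < w) (hxy : x < y)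
    (hxz : x ≤ z) (hyw : y ≤ w) (hD : {z, w} ∈ D) : {x, y} ∈ D := by
  by_cases hyz : y = z
  · subst hyz
    have := h.shift _ hD x w (by simp) (by omega) (by simp; omega)
    convert this using 1
    ext u
    simp
    omega
  · have h1 : {z, y} ∈ D := by
      rcases hyw.eq_or_lt with rfl | h2
      · exact hD
      · have := h.shift _ hD y w (by simp) h2 (by simp; omega)
        convert this using 1
        ext u
        simp
        omega
    rcases hxz.eq_or_lt with rfl | h2
    · exact h1
    · have := h.shift _ h1 x z (by simp) h2 (by simp; omega)
      convert this using 1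
      ext u
      simp
      omega

lemma slc_sub_of_not_full2 {D : Finset (Finset ℕ)} (h : SD D) {n m x y : ℕ} (hm : m < n)
    (hx : x ≤ m) (hy : y ≤ m) (hxy : x ≠ y) (hD : {x, y} ∉ D) : SubR m (slc n D) := by
  intro d hd z hz
  rw [mem_slc] at hd
  rw [Finset.mem_range]
  by_contra hzm
  have hzn := hd.1 hz
  rw [Finset.mem_range] at hzn
  have h1 : {z, n} ∈ D := h.down _ hd.2 _ (by
    intro u hu
    simp only [Finset.mem_insert, Finset.mem_singleton] at hu ⊢
    rcases hu with rfl | rfl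
    · exact Or.inr hz
    · exact Or.inl rfl)
  rcases lt_or_gt_of_ne hxy with h2 | h2
  · exact hD (sd_pair h hzn h2 (by omega) (by omega) h1)
  · rw [Finset.pair_comm] at hD
    exact hD (sd_pair h hzn h2 (by omega) (by omega) h1)

/-- the `r = 3` estimate -/
def M3 (n : ℕ) : Prop := ∀ D : Finset (Finset ℕ), Good (n + 1) 3 3 D → Full2 n D →
  (D.card : ℚ) * 64 ≤ 103 / 16 * 2 ^ (n + 1)

lemma a1_step (n : ℕ) (hA : ∀ m ≤ n, A1 m) (hM : ∀ m ≤ n, M3 m) : A1 (n + 1) := by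
  intro r t D hr ht htr hg hf
  rcases D.eq_empty_or_nonempty with rfl | hD
  · simp only [Finset.card_empty]
    push_cast
    rw [zero_mul]
    positivity
  have htn := good_le hg hD
  rcases hr.eq_or_lt with rfl | hr3
  · obtain rfl : t = 1 := by omega
    have := pair_bound (Finset.range (n + 1)) D D hg.sub hg.sub (by
      intro A hA B hB hAB
      have := hg.un ![A, B] (by intro i; fin_cases i <;> simpa)
      have e : Finset.univ.biUnion ![A, B] = A ∪ B := by
        ext x
        simp [Fin.exists_fin_two]
      rw [e, hAB] at this
      simp at this)
    rw [Finset.card_range] at this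
    have h2 : (D.card : ℚ) + D.card ≤ 2 ^ (n + 1) := by exact_mod_cast this
    norm_num
    linarith
  have hr3 : 3 ≤ r := hr3
  have hc := card_split n D
  rw [res_eq hg.sub] at hc
  have hcq : (D.card : ℚ) = (res n D).card + (slc n D).card := by rw [hc]; push_cast; rfl
  have h2r : 2 * r + 2 ≤ 2 ^ r := by
    clear * - hr3
    induction r, hr3 using Nat.le_induction with
    | base => norm_num
    | succ r hr ih => rw [pow_succ]; omega
  have h0 : ((res n D).card : ℚ) * 2 ^ (r + t) ≤ (r + t) * 2 ^ (n + 1) := by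
    rcases ht.eq_or_lt with rfl | ht2
    · obtain ⟨r, rfl⟩ : ∃ k, r = k + 1 := ⟨r - 1, by omega⟩
      have := hA n le_rfl r 1 (res n D) (by omega) le_rfl (by rw [pow_succ] at h2r; omega)
        (good_res_full hg (hf n (by omega))) (full1_res n (by omega) hf)
      rw [pow_succ 2 n, pow_succ 2 (r + 1)]
      push_cast at this ⊢
      linarith
    · obtain ⟨t, rfl⟩ : ∃ k, t = k + 1 := ⟨t - 1, by omega⟩
      have := hA n le_rfl r t (res n D) (by omega) (by omega) (by omega)
        (good_res_add (a := 1) hg) (full1_res n (by omega) hf)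
      rw [pow_succ 2 n, ← add_assoc, pow_succ 2 (r + t)]
      push_cast at this ⊢
      linarith
  have fin : ((slc n D).card : ℚ) * 2 ^ (t + r - 1) ≤ 2 ^ n →
      (D.card : ℚ) * 2 ^ (r + t) ≤ (r + t + 1) * 2 ^ (n + 1) := by
    intro h1
    have e : r + t = (t + r - 1) + 1 := by omega
    have h3 : ((slc n D).card : ℚ) * 2 ^ (r + t) ≤ 2 ^ (n + 1) := by
      rw [e, pow_succ, pow_succ]
      linarith
    rw [hcq]
    linarith
  have g1 : Good n r (t + r - 1) (slc n D) := good_slc hg ht (by omega) (by omega)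
  by_cases htL : t + 2 * r ≤ 2 ^ r
  · exact fin (a2 hA n le_rfl r _ _ hr (by omega) g1)
  obtain ⟨L, hL⟩ : ∃ L, L + 2 * r = 2 ^ r := ⟨2 ^ r - 2 * r, by omega⟩
  obtain ⟨a, rfl⟩ : ∃ a, t = L + a := ⟨t - L, by omega⟩
  obtain ⟨m, hm⟩ : ∃ m, m + a = n + 1 := ⟨n + 1 - a, by omega⟩
  by_cases hf2 : Full2 m D
  · rcases (show r = 3 ∨ 4 ≤ r by omega) with rfl | hr4
    · obtain rfl : L = 2 := by omega
      rcases (show a = 1 ∨ a = 2 by omega) with rfl | rfl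
      · obtain rfl : m = n := by omega
        have := hM m le_rfl D hg hf2
        norm_num
        have h3 : (0 : ℚ) < 2 ^ (m + 1) := by positivity
        linarith
      · obtain ⟨k, rfl⟩ : ∃ k, n = k + 1 := ⟨n - 1, by omega⟩
        obtain rfl : m = k := by omega
        have h3 := hM m (by omega) (res (m + 1) D) (good_res_add (a := 1) hg)
          (full2_res (m + 1) m le_rfl (by omega) hf2)
        have h4 := bB hA 3 4 (5 / 4) (by omega) (by omega) (by omega) (by norm_num) (by norm_num)
          (m + 1) le_rfl 2 (slc (m + 1) D) g1
        rw [hcq, pow_succ 2 (m + 1)]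
        norm_num at h3 h4 ⊢
        linarith
    · have := tT hA r (L + r - 1) L (9 / 8) hr (by omega) (by omega) (by omega) (by omega)
        (by norm_num) (beta_ok r hr4) a m D (by omega) (by omega) (by rw [hm]; exact hg) hf2
      have h3 := num_final r L a hr4 hL (by omega)
      rw [hm] at this
      rw [← add_assoc]
      refine this.trans ?_
      apply mul_le_mul_of_nonneg_right _ (by positivity)
      push_cast
      exact h3
  · unfold Full2 at hf2
    push Not at hf2
    obtain ⟨x, hx, y, hy, hxy⟩ := hf2
    have hne : x ≠ y := by
      rintro rfl
      apply hxy
      simpa using hf x (by omega)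
    obtain ⟨k, rfl⟩ : ∃ k, m = k + 1 := ⟨m - 1, by omega⟩
    have hs : SubR k (slc n D) :=
      slc_sub_of_not_full2 hg.sd (by omega) (by omega) (by omega) hne hxy
    obtain rfl : n = k + a := by omega
    have e : L + a + r - 1 = (L + r - 1) + a := by omega
    have g2 : Good k r (L + r - 1) (slc (k + a) D) := by
      rw [e] at g1
      exact good_of_sub g1 hs
    have := a2 hA k (by omega) r _ _ hr (by omega) g2
    apply fin
    rw [e, pow_add _ _ a, pow_add _ _ a, ← mul_assoc]
    exact mul_le_mul_of_nonneg_right this (by positivity)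

lemma good3_un {n s : ℕ} {D : Finset (Finset ℕ)} (h : Good n 3 s D) (A B C : Finset ℕ)
    (hA : A ∈ D) (hB : B ∈ D) (hC : C ∈ D) : (A ∪ B ∪ C).card + s ≤ n := by
  have := h.un ![A, B, C] (by intro i; fin_cases i <;> simpa)
  have e : Finset.univ.biUnion ![A, B, C] = A ∪ B ∪ C := by
    ext x
    simp [Fin.exists_fin_succ]
  rwa [e] at this

def tri (m : ℕ) (S : Finset ℕ) (D : Finset (Finset ℕ)) : Finset (Finset ℕ) :=
  (Finset.range m).powerset.filter (fun d => d ∪ S ∈ D)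

lemma mem_tri {m : ℕ} {S d : Finset ℕ} {D : Finset (Finset ℕ)} :
    d ∈ tri m S D ↔ d ⊆ Finset.range m ∧ d ∪ S ∈ D := by simp [tri]

lemma sub_tri (m : ℕ) (S : Finset ℕ) (D : Finset (Finset ℕ)) : SubR m (tri m S D) :=
  fun _ hd => (mem_tri.1 hd).1

lemma tri_split (k : ℕ) (S : Finset ℕ) (D : Finset (Finset ℕ)) :
    (tri (k + 1) S D).card = (tri k S D).card + (tri k (insert k S) D).card := by
  have h := card_split k (tri (k + 1) S D)
  rw [res_eq (sub_tri _ _ _)] at h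
  rw [h]
  congr 2
  · ext d
    simp only [mem_res, mem_tri]
    constructor
    · rintro ⟨h1, h2, h3⟩
      exact ⟨h1, h3⟩
    · rintro ⟨h1, h2⟩
      exact ⟨h1, h1.trans (by simp), h2⟩
  · ext d
    simp only [mem_slc, mem_tri]
    have e : insert k d ∪ S = d ∪ insert k S := by
      ext; simp
    rw [e]
    constructor
    · rintro ⟨h1, h2, h3⟩
      exact ⟨h1, h3⟩
    · rintro ⟨h1, h2⟩
      refine ⟨h1, ?_, h2⟩
      rw [Finset.range_add_one]
      exact Finset.insert_subset_insert _ h1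

lemma sd_tri {D : Finset (Finset ℕ)} (h : SD D) (m : ℕ) (S : Finset ℕ) (hS : ∀ s ∈ S, m ≤ s) :
    SD (tri m S D) := by
  constructor
  · intro d hd e he
    rw [mem_tri] at *
    exact ⟨he.trans hd.1, h.down _ hd.2 _ (Finset.union_subset_union_left he)⟩
  · intro d hd i j hj hij hi
    rw [mem_tri] at *
    have hjm := Finset.mem_range.1 (hd.1 hj)
    have hiS : i ∉ S := fun h => by have := hS i h; omega
    have hjS : j ∉ S := fun h => by have := hS j h; omega
    refine ⟨?_, ?_⟩
    · intro x hx
      have h2 := @hd.1 x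
      grind
    · have := h.shift _ hd.2 i j (Finset.mem_union_left _ hj) hij (by
        rw [Finset.mem_union]
        rintro (h | h)
        · exact hi h
        · exact hiS h)
      convert this using 1
      ext x
      simp only [Finset.mem_insert, Finset.mem_erase, Finset.mem_union]
      grind

lemma cross_tri {D : Finset (Finset ℕ)} {m : ℕ} (h : Good (m + 6) 3 3 D) (S T W : Finset ℕ)
    (hc : Finset.Ico m (m + 4) ⊆ S ∪ T ∪ W) : Cross m 1 (tri m S D) (tri m T D) (tri m W D) := by
  intro A hA B hB C hC
  rw [mem_tri] at hA hB hC
  have h1 := good3_un h _ _ _ hA.2 hB.2 hC.2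
  have hsub : A ∪ B ∪ C ⊆ Finset.range m :=
    Finset.union_subset (Finset.union_subset hA.1 hB.1) hC.1
  have hd : Disjoint (A ∪ B ∪ C) (Finset.Ico m (m + 4)) := by
    rw [Finset.disjoint_left]
    intro x hx hx2
    have h3 := Finset.mem_range.1 (hsub hx)
    have h4 := Finset.mem_Ico.1 hx2
    omega
  have h2 : (A ∪ B ∪ C) ∪ Finset.Ico m (m + 4) ⊆ (A ∪ S) ∪ (B ∪ T) ∪ (C ∪ W) := by
    intro x hx
    have h3 := @hc x
    simp only [Finset.mem_union] at *
    tauto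
  have h3 := Finset.card_le_card h2
  rw [Finset.card_union_of_disjoint hd, Nat.card_Ico] at h3
  omega

lemma res_slc_sub {D : Finset (Finset ℕ)} (h : SD D) {N k : ℕ} (hk : N < k) :
    res N (slc k D) ⊆ slc N D := by
  intro d hd
  rw [mem_res, mem_slc] at hd
  rw [mem_slc]
  refine ⟨hd.1, ?_⟩
  have hNd : N ∉ d := fun h => by simpa using hd.1 h
  have hkd : k ∉ d := fun h => by simpa using hd.2.1 h
  have := h.shift _ hd.2.2 N k (by simp) hk (by
    rw [Finset.mem_insert]
    rintro (h | h)
    · omega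
    · exact hNd h)
  rwa [Finset.erase_insert hkd] at this

lemma res_res {D : Finset (Finset ℕ)} {a b : ℕ} (h : a ≤ b) : res a (res b D) = res a D := by
  ext d
  simp only [mem_res]
  constructor
  · rintro ⟨h1, _, h3⟩
    exact ⟨h1, h3⟩
  · rintro ⟨h1, h2⟩
    exact ⟨h1, h1.trans (by simpa using h), h2⟩

lemma slc_res {D : Finset (Finset ℕ)} {a b : ℕ} (h : a < b) : slc a (res b D) = slc a D := by
  ext d
  simp only [mem_slc, mem_res]
  constructor
  · rintro ⟨h1, _, h3⟩
    exact ⟨h1, h3⟩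
  · rintro ⟨h1, h2⟩
    refine ⟨h1, ?_, h2⟩
    intro x hx
    rw [Finset.mem_range]
    rcases Finset.mem_insert.1 hx with rfl | hx
    · exact h
    · have := Finset.mem_range.1 (h1 hx)
      omega

lemma tops {M : ℕ} (hA : ∀ m ≤ M, A1 m) {N : ℕ} (hN : N + 2 ≤ M) {D : Finset (Finset ℕ)}
    (h : Good (N + 3) 3 3 D) :
    (D.card : ℚ) ≤ (res N D).card + 3 * (slc N D).card + 325 / 4096 * 2 ^ N := by
  have B := bB hA 3 4 (5 / 4) (by omega) (by omega) (by omega) (by norm_num) (by norm_num)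
  have c1 := card_split (N + 2) D
  rw [res_eq (show SubR (N + 2 + 1) D from h.sub)] at c1
  have c2 : (res (N + 2) D).card = _ := card_split (N + 1) D
  have c3 := card_split N D
  have g2 : Good (N + 2) 3 5 (slc (N + 2) D) := good_slc h (by omega) (by omega) (by omega)
  have r2 : Good (N + 2) 3 2 (res (N + 2) D) := good_res_add (a := 1) h
  have g1 : Good (N + 1) 3 4 (slc (N + 1) D) := by
    have := good_slc (s := 4) r2 (by omega) (by omega) (by omega)
    rwa [slc_res (by omega)] at this
  have d1 := card_split N (slc (N + 1) D)
  rw [res_eq g1.sub] at d1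
  have d2 := card_split (N + 1) (slc (N + 2) D)
  rw [res_eq g2.sub] at d2
  have d3 := card_split N (slc (N + 2) D)
  have l1 := Finset.card_le_card (res_slc_sub h.sd (show N < N + 1 by omega))
  have l2 := Finset.card_le_card (res_slc_sub h.sd (show N < N + 2 by omega))
  have b1 := B N (by omega) 2 (slc N (slc (N + 1) D))
    (good_slc g1 (by omega) (by omega) (by omega))
  have b2 := B (N + 1) (by omega) 3 (slc (N + 1) (slc (N + 2) D))
    (good_slc g2 (by omega) (by omega) (by omega))
  have g3 : Good (N + 1) 3 4 (res (N + 1) (slc (N + 2) D)) := good_res_add (a := 1) g2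
  have b3 := B N (by omega) 2 (slc N (slc (N + 2) D)) (by
    have := good_slc (s := 6) g3 (by omega) (by omega) (by omega)
    rwa [slc_res (by omega)] at this)
  have tot : D.card ≤ (res N D).card + 3 * (slc N D).card + (slc N (slc (N + 1) D)).card +
    (slc (N + 1) (slc (N + 2) D)).card + (slc N (slc (N + 2) D)).card := by omega
  have totq : (D.card : ℚ) ≤ (res N D).card + 3 * (slc N D).card + (slc N (slc (N + 1) D)).card +
    (slc (N + 1) (slc (N + 2) D)).card + (slc N (slc (N + 2) D)).card := by exact_mod_cast tot
  rw [pow_succ 2 N] at b2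
  norm_num at b1 b2 b3
  linarith

lemma m3 {n : ℕ} (hA : ∀ m ≤ n, A1 m) : M3 n := by
  intro D hg hf
  rcases D.eq_empty_or_nonempty with rfl | hD
  · simp only [Finset.card_empty]
    push_cast
    rw [zero_mul]
    positivity
  have hn2 := good_le hg hD
  have hn5 : 5 ≤ n := by
    by_contra hcon
    have h1 := good3_un hg {0, 1} {n - 2, n - 1} {0, 1} (hf _ (by omega) _ (by omega))
      (hf _ (by omega) _ (by omega)) (hf _ (by omega) _ (by omega))
    have h2 : Finset.range n ⊆ {0, 1} ∪ {n - 2, n - 1} ∪ {0, 1} := by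
      intro x hx
      simp at hx ⊢
      omega
    have h3 := Finset.card_le_card h2
    rw [Finset.card_range] at h3
    omega
  obtain ⟨m, rfl⟩ : ∃ m, n = m + 5 := ⟨n - 5, by omega⟩
  have hg : Good (m + 6) 3 3 D := hg
  have hD0 := empty_mem hg.sd hD
  have t1 := tops hA (N := m + 3) (by omega) hg
  have gG : Good (m + 3) 3 3 (slc (m + 3) D) := by
    have h1 : Good (m + 4) 3 1 (res (m + 4) D) := good_res_add (a := 2) hg
    have := good_slc (s := 3) h1 (by omega) (by omega) (by omega)
    rwa [slc_res (by omega)] at this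
  have t2 := tops hA (N := m) (by omega) gG
  have gG0 : Good m 3 3 (slc m (slc (m + 3) D)) := by
    have h1 : Good (m + 1) 3 1 (res (m + 1) (slc (m + 3) D)) := good_res_add (a := 2) gG
    have := good_slc (s := 3) h1 (by omega) (by omega) (by omega)
    rwa [slc_res (by omega)] at this
  have t3 := a2 hA m (by omega) 3 3 _ (by omega) (by omega) gG0
  have eG : res m (slc (m + 3) D) = tri m {m + 3} D := by
    ext d
    simp only [mem_res, mem_slc, mem_tri]
    have e : insert (m + 3) d = d ∪ {m + 3} := by ext; simp [or_comm]
    rw [e]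
    constructor
    · rintro ⟨h1, _, h3⟩
      exact ⟨h1, h3⟩
    · rintro ⟨h1, h2⟩
      exact ⟨h1, h1.trans (by simp), h2⟩
  rw [eG] at t2
  have eE : res (m + 3) D = tri (m + 3) ∅ D := by
    ext d
    simp only [mem_res, mem_tri, Finset.union_empty]
  rw [eE] at t1
  -- the eight pieces
  have s1 : (tri (m + 3) ∅ D).card = _ := tri_split (m + 2) ∅ D
  have s2 : (tri (m + 2) ∅ D).card = _ := tri_split (m + 1) ∅ D
  have s3 : (tri (m + 2) (insert (m + 2) ∅) D).card = _ := tri_split (m + 1) (insert (m + 2) ∅) D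
  have s4 := tri_split m ∅ D
  have s5 := tri_split m (insert (m + 1) ∅) D
  have s6 := tri_split m (insert (m + 2) ∅) D
  have s7 := tri_split m (insert (m + 1) (insert (m + 2) ∅)) D
  have f1 : ∀ s, m ≤ s → s < m + 5 → Full1 m (tri m {s} D) := by
    intro s _ hs x hx
    rw [mem_tri]
    refine ⟨by simpa using hx, ?_⟩
    have := hf x (by omega) s hs
    simpa using this
  have f0 : Full1 m (tri m ∅ D) := by
    intro x hx
    rw [mem_tri]
    refine ⟨by simpa using hx, ?_⟩
    have := hf x (by omega) x (by omega)
    simpa using this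
  have z0 : ∅ ∈ tri m ∅ D := by
    rw [mem_tri]
    exact ⟨by simp, by simpa using hD0⟩
  have z1 : ∀ s, s < m + 5 → ∅ ∈ tri m {s} D := by
    intro s hs
    rw [mem_tri]
    exact ⟨by simp, by simpa using hf s hs s hs⟩
  have z2 : ∀ s u, s < m + 5 → u < m + 5 → ∅ ∈ tri m {s, u} D := by
    intro s u hs hu
    rw [mem_tri]
    exact ⟨by simp, by simpa using hf s hs u hu⟩
  have sdt : ∀ S : Finset ℕ, (∀ s ∈ S, m ≤ s) → SD (tri m S D) := fun S hS => sd_tri hg.sd m S hS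
  -- pair inequalities
  have pr : ∀ S T W : Finset ℕ, Finset.Ico m (m + 4) ⊆ S ∪ T ∪ W → ∅ ∈ tri m W D →
      (tri m S D).card + (tri m T D).card ≤ 2 ^ m := fun S T W h hW =>
    cross_pair (cross_tri hg S T W h) (sub_tri _ _ _) (sub_tri _ _ _) hW
  have c2 : ∀ S T W : Finset ℕ, Finset.Ico m (m + 4) ⊆ S ∪ T ∪ W → (∀ s ∈ S, m ≤ s) →
      (∀ s ∈ T, m ≤ s) → (∀ s ∈ W, m ≤ s) → Full1 m (tri m S D) → Full1 m (tri m W D) →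
      ∅ ∈ tri m S D → ∅ ∈ tri m T D → ∅ ∈ tri m W D →
      8 * ((tri m S D).card + (tri m T D).card + (tri m W D).card) ≤ 9 * 2 ^ m :=
    fun S T W h hS hT hW fS fW eS eT eW =>
      cross_c2 m _ _ _ (sdt S hS) (sdt T hT) (sdt W hW) (sub_tri _ _ _) (sub_tri _ _ _)
        (sub_tri _ _ _) fS fW eS eT eW (cross_tri hg S T W h)
  have p0 := pr ∅ {m, m + 1, m + 2} {m + 3} (by intro x; simp; omega) (z1 _ (by omega))
  have p1 := pr {m} {m + 1, m + 2} {m + 3} (by intro x; simp; omega) (z1 _ (by omega))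
  have p2 := pr {m + 1} {m, m + 2} {m + 3} (by intro x; simp; omega) (z1 _ (by omega))
  have p3 := pr {m + 2} {m, m + 1} {m + 3} (by intro x; simp; omega) (z1 _ (by omega))
  have p4 := pr {m} {m + 3} {m + 1, m + 2} (by intro x; simp; omega) (z2 _ _ (by omega) (by omega))
  have p5 := pr ∅ {m + 1, m + 2} {m, m + 3} (by intro x; simp; omega) (z2 _ _ (by omega) (by omega))
  have q1 := c2 {m} {m + 1, m + 2} {m + 3} (by intro x; simp; omega) (by simp) (by simp)
    (by simp) (f1 _ (by omega) (by omega)) (f1 _ (by omega) (by omega)) (z1 _ (by omega))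
    (z2 _ _ (by omega) (by omega)) (z1 _ (by omega))
  have q2 := c2 {m + 1} {m, m + 2} {m + 3} (by intro x; simp; omega) (by simp) (by simp)
    (by simp) (f1 _ (by omega) (by omega)) (f1 _ (by omega) (by omega)) (z1 _ (by omega))
    (z2 _ _ (by omega) (by omega)) (z1 _ (by omega))
  have q3 := c2 {m + 2} {m, m + 1} {m + 3} (by intro x; simp; omega) (by simp) (by simp)
    (by simp) (f1 _ (by omega) (by omega)) (f1 _ (by omega) (by omega)) (z1 _ (by omega))
    (z2 _ _ (by omega) (by omega)) (z1 _ (by omega))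
  have q0 : (tri m {m, m + 1, m + 2} D).Nonempty → 8 * ((tri m ∅ D).card +
      (tri m {m, m + 1, m + 2} D).card + (tri m {m + 3} D).card) ≤ 9 * 2 ^ m := fun hne =>
    c2 ∅ {m, m + 1, m + 2} {m + 3} (by intro x; simp; omega) (by simp) (by simp)
      (by simp) f0 (f1 _ (by omega) (by omega)) z0
      (empty_mem (sdt _ (by simp)) hne) (z1 _ (by omega))
  simp only [insert_empty_eq] at s1 s2 s3 s4 s5 s6 s7
  have sE : (tri (m + 3) ∅ D).card = (tri m ∅ D).card + (tri m {m} D).card +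
      (tri m {m + 1} D).card + (tri m {m + 2} D).card + (tri m {m + 1, m + 2} D).card +
      (tri m {m, m + 2} D).card + (tri m {m, m + 1} D).card +
      (tri m {m, m + 1, m + 2} D).card := by omega
  have main : 8 * (tri (m + 3) ∅ D).card + 24 * (tri m {m + 3} D).card ≤ 35 * 2 ^ m := by
    rcases (tri m {m, m + 1, m + 2} D).eq_empty_or_nonempty with h | h
    · rw [h, Finset.card_empty] at sE
      omega
    · have := q0 h
      omega
  have mainq : 8 * ((tri (m + 3) ∅ D).card : ℚ) + 24 * (tri m {m + 3} D).card ≤ 35 * 2 ^ m := by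
    exact_mod_cast main
  have hp : (0 : ℚ) < 2 ^ m := by positivity
  have e6 : (2 : ℚ) ^ (m + 5 + 1) = 64 * 2 ^ m := by ring
  have e3 : (2 : ℚ) ^ (m + 3) = 8 * 2 ^ m := by ring
  rw [e6]
  rw [e3] at t1
  norm_num at t3
  linarith

lemma a1_all (n : ℕ) : A1 n := by
  induction n using Nat.strong_induction_on with
  | _ n ih =>
    rcases n with _ | n
    · intro r t D _ ht _ hg _
      rcases D.eq_empty_or_nonempty with rfl | hD
      · simp only [Finset.card_empty]
        push_cast
        rw [zero_mul]
        positivity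
      · have := good_le hg hD
        omega
    · have hA : ∀ m ≤ n, A1 m := fun m hm => ih m (by omega)
      exact a1_step n hA (fun m hm => m3 (fun k hk => hA k (by omega)))

/-! ### shifting -/

structure UF (n r t : ℕ) (D : Finset (Finset ℕ)) : Prop where
  down : ∀ d ∈ D, ∀ e, e ⊆ d → e ∈ D
  sub : SubR n D
  un : ∀ f : Fin r → Finset ℕ, (∀ i, f i ∈ D) → (Finset.univ.biUnion f).card + t ≤ n

def shf (i j : ℕ) (D : Finset (Finset ℕ)) (a : Finset ℕ) : Finset ℕ :=
  if j ∈ a ∧ i ∉ a ∧ insert i (a.erase j) ∉ D then insert i (a.erase j) else a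

lemma swap_swap {i j : ℕ} {a : Finset ℕ} (hj : j ∈ a) (hi : i ∉ a) :
    insert j ((insert i (a.erase j)).erase i) = a := by
  have hij : i ≠ j := fun h => hi (h ▸ hj)
  ext x
  simp only [Finset.mem_insert, Finset.mem_erase]
  by_cases h1 : x = i <;> by_cases h2 : x = j <;> grind

lemma shf_inj (i j : ℕ) (D : Finset (Finset ℕ)) : Set.InjOn (shf i j D) (D : Set (Finset ℕ)) := by
  intro a ha b hb hab
  have ha : a ∈ D := ha
  have hb : b ∈ D := hb
  unfold shf at hab
  split_ifs at hab with h1 h2 h2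
  · rw [← swap_swap h1.1 h1.2.1, hab, swap_swap h2.1 h2.2.1]
  · exact absurd (hab ▸ hb) h1.2.2
  · exact absurd (hab ▸ ha) h2.2.2
  · exact hab

lemma mem_shf {i j : ℕ} (hij : i ≠ j) {D : Finset (Finset ℕ)} {d : Finset ℕ} :
    d ∈ D.image (shf i j D) ↔ (d ∈ D ∧ (j ∈ d → i ∉ d → insert i (d.erase j) ∈ D)) ∨
      (d ∉ D ∧ i ∈ d ∧ j ∉ d ∧ insert j (d.erase i) ∈ D) := by
  rw [Finset.mem_image]
  constructor
  · rintro ⟨a, ha, rfl⟩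
    unfold shf
    split_ifs with h
    · right
      refine ⟨h.2.2, Finset.mem_insert_self _ _, ?_, ?_⟩
      · simp [hij.symm]
      · rw [swap_swap h.1 h.2.1]
        exact ha
    · left
      refine ⟨ha, ?_⟩
      intro h1 h2
      by_contra h3
      exact h ⟨h1, h2, h3⟩
  · rintro (⟨h1, h2⟩ | ⟨h1, h2, h3, h4⟩)
    · refine ⟨d, h1, ?_⟩
      unfold shf
      rw [if_neg]
      rintro ⟨h3, h4, h5⟩
      exact h5 (h2 h3 h4)
    · refine ⟨_, h4, ?_⟩
      have e := swap_swap h2 h3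
      unfold shf
      rw [if_pos]
      · exact e
      · refine ⟨Finset.mem_insert_self _ _, ?_, ?_⟩
        · simp [hij]
        · rw [e]
          exact h1

lemma uf_shf {n r t i j : ℕ} (hij : i < j) {D : Finset (Finset ℕ)} (h : UF n r t D) :
    UF n r t (D.image (shf i j D)) := by
  have hne : i ≠ j := by omega
  refine ⟨?_, ?_, ?_⟩
  · intro d hd e he
    rw [mem_shf hne] at hd ⊢
    rcases hd with ⟨h1, h2⟩ | ⟨h1, h2, h3, h4⟩
    · left
      refine ⟨h.down d h1 e he, ?_⟩
      intro hje hie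
      by_cases hid : i ∈ d
      · refine h.down d h1 _ ?_
        intro x hx
        rcases Finset.mem_insert.1 hx with rfl | hx
        · exact hid
        · exact he (Finset.mem_of_mem_erase hx)
      · refine h.down _ (h2 (he hje) hid) _ ?_
        exact Finset.insert_subset_insert _ (Finset.erase_subset_erase _ he)
    · have hje : j ∉ e := fun h => h3 (he h)
      by_cases heD : e ∈ D
      · left
        exact ⟨heD, fun h => absurd h hje⟩
      · right
        refine ⟨heD, ?_, hje, ?_⟩
        · by_contra hie
          apply heD
          refine h.down _ h4 _ ?_
          intro x hx
          refine Finset.mem_insert_of_mem (Finset.mem_erase.2 ⟨?_, he hx⟩)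
          rintro rfl
          exact hie hx
        · refine h.down _ h4 _ ?_
          exact Finset.insert_subset_insert _ (Finset.erase_subset_erase _ he)
  · intro d hd
    rw [mem_shf hne] at hd
    rcases hd with ⟨h1, h2⟩ | ⟨h1, h2, h3, h4⟩
    · exact h.sub d h1
    · have h5 := h.sub _ h4
      intro x hx
      by_cases hxi : x = i
      · have := Finset.mem_range.1 (h5 (Finset.mem_insert_self _ _))
        rw [Finset.mem_range]
        omega
      · exact h5 (Finset.mem_insert_of_mem (Finset.mem_erase.2 ⟨hxi, hx⟩))
  · intro f hf
    have hf2 := fun k => (mem_shf hne).1 (hf k)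
    by_cases hall : ∀ k, f k ∈ D
    · exact h.un f hall
    push Not at hall
    obtain ⟨k0, hk0⟩ := hall
    have hm0 : i ∈ f k0 ∧ j ∉ f k0 := by
      rcases hf2 k0 with h1 | h1
      · exact absurd h1.1 hk0
      · exact ⟨h1.2.1, h1.2.2.1⟩
    by_cases hj : ∃ k, j ∈ f k
    · -- both covered
      let g : Fin r → Finset ℕ := fun k =>
        if f k ∈ D then (if j ∈ f k ∧ i ∉ f k then insert i ((f k).erase j) else f k)
        else insert j ((f k).erase i)
      have hg : ∀ k, g k ∈ D := by
        intro k
        simp only [g]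
        rcases hf2 k with h1 | h1
        · rw [if_pos h1.1]
          split_ifs with h2
          · exact h1.2 h2.1 h2.2
          · exact h1.1
        · rw [if_neg h1.1]
          exact h1.2.2.2
      have hsub : Finset.univ.biUnion f ⊆ Finset.univ.biUnion g := by
        intro x hx
        obtain ⟨k, _, hk⟩ := Finset.mem_biUnion.1 hx
        rw [Finset.mem_biUnion]
        by_cases hxj : x = j
        · refine ⟨k0, Finset.mem_univ _, ?_⟩
          simp [g, hk0, hxj]
        · by_cases hxi : x = i
          · obtain ⟨k1, hk1⟩ := hj
            refine ⟨k1, Finset.mem_univ _, ?_⟩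
            have h1 : f k1 ∈ D := by
              rcases hf2 k1 with h1 | h1
              · exact h1.1
              · exact absurd hk1 h1.2.2.1
            simp only [g]
            rw [if_pos h1]
            split_ifs with h2
            · simp [hxi]
            · by_contra h3
              exact h2 ⟨hk1, fun h4 => h3 (hxi ▸ h4)⟩
          · refine ⟨k, Finset.mem_univ _, ?_⟩
            simp only [g]
            split_ifs <;> simp [hxi, hxj, hk]
      have h1 := h.un g hg
      have h2 := Finset.card_le_card hsub
      omega
    · push Not at hj
      let g : Fin r → Finset ℕ := fun k =>
        if f k ∈ D then f k else insert j ((f k).erase i)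
      have hg : ∀ k, g k ∈ D := by
        intro k
        simp only [g]
        rcases hf2 k with h1 | h1
        · rw [if_pos h1.1]
          exact h1.1
        · rw [if_neg h1.1]
          exact h1.2.2.2
      have hsub : insert j ((Finset.univ.biUnion f).erase i) ⊆ Finset.univ.biUnion g := by
        intro x hx
        rw [Finset.mem_biUnion]
        rcases Finset.mem_insert.1 hx with rfl | hx
        · refine ⟨k0, Finset.mem_univ _, ?_⟩
          simp [g, hk0]
        · obtain ⟨hxi, hx⟩ := Finset.mem_erase.1 hx
          obtain ⟨k, _, hk⟩ := Finset.mem_biUnion.1 hx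
          refine ⟨k, Finset.mem_univ _, ?_⟩
          simp only [g]
          split_ifs <;> simp [hxi, hk]
      have h1 := h.un g hg
      have h2 := Finset.card_le_card hsub
      have hiU : i ∈ Finset.univ.biUnion f :=
        Finset.mem_biUnion.2 ⟨k0, Finset.mem_univ _, hm0.1⟩
      have hjU : j ∉ (Finset.univ.biUnion f).erase i := by
        intro h3
        obtain ⟨k, _, hk⟩ := Finset.mem_biUnion.1 (Finset.mem_of_mem_erase h3)
        exact hj k hk
      rw [Finset.card_insert_of_notMem hjU, Finset.card_erase_add_one hiU] at h2
      omega

lemma full1_shf {n i j : ℕ} (hij : i < j) {D : Finset (Finset ℕ)} (h : Full1 n D) :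
    Full1 n (D.image (shf i j D)) := by
  intro x hx
  rw [mem_shf (by omega)]
  left
  refine ⟨h x hx, ?_⟩
  intro hj _
  have hjx : j = x := by simpa using hj
  subst hjx
  simpa using h i (by omega)

def wt (D : Finset (Finset ℕ)) : ℕ := ∑ d ∈ D, ∑ x ∈ d, x

lemma wt_shf {i j : ℕ} (hij : i < j) {D : Finset (Finset ℕ)} {d : Finset ℕ} (hd : d ∈ D)
    (hj : j ∈ d) (hi : i ∉ d) (hs : insert i (d.erase j) ∉ D) :
    wt (D.image (shf i j D)) < wt D := by
  unfold wt
  rw [Finset.sum_image (shf_inj i j D)]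
  have key : ∀ a : Finset ℕ, j ∈ a → i ∉ a →
      ∑ x ∈ insert i (a.erase j), x < ∑ x ∈ a, x := by
    intro a h1 h2
    have h3 : i ∉ a.erase j := fun h => h2 (Finset.mem_of_mem_erase h)
    rw [Finset.sum_insert h3]
    have := Finset.sum_erase_add a (fun x => x) h1
    omega
  apply Finset.sum_lt_sum
  · intro a ha
    unfold shf
    split_ifs with h
    · exact (key a h.1 h.2.1).le
    · exact le_rfl
  · refine ⟨d, hd, ?_⟩
    unfold shf
    rw [if_pos ⟨hj, hi, hs⟩]
    exact key d hj hi

lemma exists_shifted {n r t : ℕ} : ∀ (w : ℕ) (D : Finset (Finset ℕ)), wt D = w → UF n r t D →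
    Full1 n D → ∃ D' : Finset (Finset ℕ), Good n r t D' ∧ Full1 n D' ∧ D'.card = D.card := by
  intro w
  induction w using Nat.strong_induction_on with
  | _ w ih =>
    intro D hw h hf
    by_cases hs : ∀ d ∈ D, ∀ i j, j ∈ d → i < j → i ∉ d → insert i (d.erase j) ∈ D
    · exact ⟨D, ⟨⟨h.down, hs⟩, h.sub, h.un⟩, hf, rfl⟩
    · push Not at hs
      obtain ⟨d, hd, i, j, hj, hij, hi, hns⟩ := hs
      have hlt := wt_shf hij hd hj hi hns
      obtain ⟨D', h1, h2, h3⟩ := ih _ (hw ▸ hlt) _ rfl (uf_shf hij h) (full1_shf hij hf)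
      refine ⟨D', h1, h2, ?_⟩
      rw [h3, Finset.card_image_of_injOn (shf_inj i j D)]

lemma uf_bound {n r t : ℕ} {D : Finset (Finset ℕ)} (hr : 2 ≤ r) (ht : 1 ≤ t)
    (htr : t + r + 1 ≤ 2 ^ r) (h : UF n r t D) (hf : Full1 n D) :
    (D.card : ℚ) * 2 ^ (r + t) ≤ (r + t + 1) * 2 ^ n := by
  obtain ⟨D', h1, h2, h3⟩ := exists_shifted _ D rfl h hf
  rw [← h3]
  exact a1_all n r t D' hr ht htr h1 h2

/-! ### from agreeing to union families -/

section Agree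

variable {α : Type} [DecidableEq α]

def agr {r : ℕ} (X : Finset α) (f : Fin r → Finset α) : Finset α :=
  X.filter (fun x => (∀ i, x ∈ f i) ∨ (∀ i, x ∉ f i))

lemma mem_agr {r : ℕ} {X : Finset α} {f : Fin r → Finset α} {x : α} :
    x ∈ agr X f ↔ x ∈ X ∧ ((∀ i, x ∈ f i) ∨ (∀ i, x ∉ f i)) := by simp [agr]

structure AF (X : Finset α) (r t : ℕ) (F : Finset (Finset α)) : Prop where
  sub : ∀ A ∈ F, A ⊆ X
  nt1 : ∀ x ∈ X, ∃ A ∈ F, x ∉ A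
  nt2 : ∀ x ∈ X, ∃ A ∈ F, x ∈ A
  ag : ∀ f : Fin r → Finset α, (∀ i, f i ∈ F) → t ≤ (agr X f).card

/-- the stable case -/
lemma af_stable {X : Finset α} {r t : ℕ} {F : Finset (Finset α)} (h : AF X r t F) (hr : 2 ≤ r)
    (ht : 1 ≤ t) (htr : t + r + 1 ≤ 2 ^ r) (hst : ∀ y ∈ X, ∀ A ∈ F, A.erase y ∈ F) :
    (F.card : ℚ) * 2 ^ (r + t) ≤ (r + t + 1) * 2 ^ X.card := by
  have hsd : ∀ A ∈ F, ∀ S : Finset α, A \ S ∈ F := by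
    intro A hA S
    induction S using Finset.induction_on with
    | empty => simpa using hA
    | insert y S _ ih =>
      rw [Finset.sdiff_insert]
      by_cases hy : y ∈ X
      · exact hst y hy _ ih
      · rw [Finset.erase_eq_of_notMem]
        · exact ih
        · intro h2
          exact hy (h.sub A hA (Finset.mem_sdiff.1 h2).1)
  have hdown : ∀ A ∈ F, ∀ B, B ⊆ A → B ∈ F := by
    intro A hA B hB
    have := hsd A hA (A \ B)
    rwa [Finset.sdiff_sdiff_eq_self hB] at this
  have hun : ∀ f : Fin r → Finset α, (∀ i, f i ∈ F) →
      (Finset.univ.biUnion f).card + t ≤ X.card := by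
    intro f hf
    let i0 : Fin r := ⟨0, by omega⟩
    let i1 : Fin r := ⟨1, by omega⟩
    have hne : i1 ≠ i0 := by simp [i0, i1]
    let g : Fin r → Finset α := Function.update f i0 (f i0 \ f i1)
    have hg0 : g i0 = f i0 \ f i1 := by simp [g]
    have hgk : ∀ k, k ≠ i0 → g k = f k := fun k hk => by simp [g, hk]
    have hg : ∀ k, g k ∈ F := by
      intro k
      by_cases hk : k = i0
      · rw [hk, hg0]
        exact hsd _ (hf _) _
      · rw [hgk k hk]
        exact hf k
    have h1 := h.ag g hg
    have hsub : agr X g ⊆ X \ Finset.univ.biUnion f := by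
      intro x hx
      obtain ⟨hxX, hx⟩ := mem_agr.1 hx
      rw [Finset.mem_sdiff]
      refine ⟨hxX, ?_⟩
      intro hxU
      obtain ⟨k, _, hk⟩ := Finset.mem_biUnion.1 hxU
      rcases hx with hx | hx
      · have h2 := hx i0
        have h3 := hx i1
        rw [hg0] at h2
        rw [hgk i1 hne] at h3
        exact (Finset.mem_sdiff.1 h2).2 h3
      · have h3 := hx i1
        rw [hgk i1 hne] at h3
        by_cases hk0 : k = i0
        · have h2 := hx i0
          rw [hg0] at h2
          rw [hk0] at hk
          exact h2 (Finset.mem_sdiff.2 ⟨hk, h3⟩)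
        · have h2 := hx k
          rw [hgk k hk0] at h2
          exact h2 hk
    have hUX : Finset.univ.biUnion f ⊆ X :=
      Finset.biUnion_subset.2 (fun i _ => h.sub _ (hf i))
    have h2 := Finset.card_le_card hsub
    have h3 := Finset.card_sdiff_add_card_eq_card hUX
    omega
  -- relabel
  let φ : α → ℕ := fun x => if hx : x ∈ X then (X.equivFin ⟨x, hx⟩).val else 0
  have hφ : ∀ x (hx : x ∈ X), φ x = (X.equivFin ⟨x, hx⟩).val := fun x hx => by simp [φ, hx]
  have hlt : ∀ x ∈ X, φ x < X.card := fun x hx => by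
    rw [hφ x hx]
    exact (X.equivFin ⟨x, hx⟩).2
  have hinj : Set.InjOn φ (X : Set α) := by
    intro x hx y hy hxy
    rw [hφ x hx, hφ y hy] at hxy
    have := X.equivFin.injective (Fin.ext hxy)
    simpa using this
  have hsurj : ∀ s < X.card, ∃ x ∈ X, φ x = s := by
    intro s hs
    refine ⟨(X.equivFin.symm ⟨s, hs⟩ : X), (X.equivFin.symm ⟨s, hs⟩).2, ?_⟩
    rw [hφ _ (X.equivFin.symm ⟨s, hs⟩).2]
    simp
  let pb : Finset ℕ → Finset α := fun d => X.filter (fun x => φ x ∈ d)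
  have pb_sub : ∀ d, pb d ⊆ X := fun d => Finset.filter_subset _ _
  have mem_pb : ∀ d x, x ∈ pb d ↔ x ∈ X ∧ φ x ∈ d := fun d x => by simp [pb]
  have pb1 : ∀ d, d ⊆ Finset.range X.card → (pb d).image φ = d := by
    intro d hd
    ext s
    rw [Finset.mem_image]
    constructor
    · rintro ⟨x, hx, rfl⟩
      exact ((mem_pb d x).1 hx).2
    · intro hs
      obtain ⟨x, hx, rfl⟩ := hsurj s (Finset.mem_range.1 (hd hs))
      exact ⟨x, (mem_pb d x).2 ⟨hx, hs⟩, rfl⟩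
  have pb2 : ∀ A, A ⊆ X → pb (A.image φ) = A := by
    intro A hA
    ext x
    rw [mem_pb, Finset.mem_image]
    constructor
    · rintro ⟨hx, y, hy, hxy⟩
      have := hinj (hA hy) hx hxy
      exact this ▸ hy
    · intro hx
      exact ⟨hA hx, x, hx, rfl⟩
  have pbc : ∀ d, d ⊆ Finset.range X.card → (pb d).card = d.card := by
    intro d hd
    have := Finset.card_image_of_injOn (s := pb d) (f := φ) (hinj.mono (by exact_mod_cast pb_sub d))
    rw [← this, pb1 d hd]
  let D : Finset (Finset ℕ) := (Finset.range X.card).powerset.filter (fun d => pb d ∈ F)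
  have mem_D : ∀ d, d ∈ D ↔ d ⊆ Finset.range X.card ∧ pb d ∈ F := fun d => by simp [D]
  have hcard : D.card = F.card := by
    apply Finset.card_nbij' pb (fun A => A.image φ)
    · intro d hd
      exact ((mem_D d).1 hd).2
    · intro A hA
      have hA : A ∈ F := hA
      refine (mem_D _).2 ⟨?_, ?_⟩
      · intro s hs
        obtain ⟨x, hx, rfl⟩ := Finset.mem_image.1 hs
        exact Finset.mem_range.2 (hlt x (h.sub A hA hx))
      · rw [pb2 A (h.sub A hA)]
        exact hA
    · intro d hd
      exact pb1 d ((mem_D d).1 hd).1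
    · intro A hA
      exact pb2 A (h.sub A hA)
  rw [← hcard]
  apply uf_bound hr ht htr
  · refine ⟨?_, ?_, ?_⟩
    · intro d hd e he
      rw [mem_D] at *
      refine ⟨he.trans hd.1, hdown _ hd.2 _ ?_⟩
      intro x hx
      rw [mem_pb] at *
      exact ⟨hx.1, he hx.2⟩
    · intro d hd
      exact ((mem_D d).1 hd).1
    · intro f hf
      have h1 := hun (fun k => pb (f k)) (fun k => ((mem_D _).1 (hf k)).2)
      have h2 : Finset.univ.biUnion (fun k => pb (f k)) = pb (Finset.univ.biUnion f) := by
        ext x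
        simp only [Finset.mem_biUnion, mem_pb]
        constructor
        · rintro ⟨k, hk, h1, h2⟩
          exact ⟨h1, k, hk, h2⟩
        · rintro ⟨h1, k, hk, h2⟩
          exact ⟨k, hk, h1, h2⟩
      rw [h2, pbc] at h1
      · exact h1
      · exact Finset.biUnion_subset.2 (fun k _ => ((mem_D _).1 (hf k)).1)
  · intro s hs
    obtain ⟨x, hx, rfl⟩ := hsurj s hs
    rw [mem_D]
    refine ⟨by simpa using hlt x hx, ?_⟩
    obtain ⟨A, hA, hxA⟩ := h.nt2 x hx
    refine hdown A hA _ ?_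
    intro y hy
    rw [mem_pb, Finset.mem_singleton] at hy
    have := hinj hy.1 hx hy.2
    exact this ▸ hxA

def dcmp (y : α) (F : Finset (Finset α)) (A : Finset α) : Finset α :=
  if A.erase y ∈ F then A else A.erase y

lemma cmp_inj (y : α) (F : Finset (Finset α)) : Set.InjOn (dcmp y F) (F : Set (Finset α)) := by
  intro a ha b hb hab
  have ha : a ∈ F := ha
  have hb : b ∈ F := hb
  unfold dcmp at hab
  split_ifs at hab with h1 h2 h2
  · exact hab
  · exact absurd (hab ▸ ha) h2
  · exact absurd (hab ▸ hb) h1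
  · have hya : y ∈ a := by
      by_contra h
      rw [Finset.erase_eq_of_notMem h] at h1
      exact h1 ha
    have hyb : y ∈ b := by
      by_contra h
      rw [Finset.erase_eq_of_notMem h] at h2
      exact h2 hb
    rw [← Finset.insert_erase hya, hab, Finset.insert_erase hyb]

lemma mem_cmp {y : α} {F : Finset (Finset α)} {d : Finset α} (hd : d ∈ F.image (dcmp y F)) :
    (d ∈ F ∧ d.erase y ∈ F) ∨ (d ∉ F ∧ y ∉ d ∧ insert y d ∈ F) := by
  obtain ⟨A, hA, rfl⟩ := Finset.mem_image.1 hd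
  unfold dcmp
  split_ifs with h
  · exact Or.inl ⟨hA, h⟩
  · right
    have hya : y ∈ A := by
      by_contra h2
      rw [Finset.erase_eq_of_notMem h2] at h
      exact h hA
    refine ⟨h, by simp, ?_⟩
    rwa [Finset.insert_erase hya]

lemma cmp_ne {y x : α} (hxy : x ≠ y) (F : Finset (Finset α)) (A : Finset α) :
    x ∈ dcmp y F A ↔ x ∈ A := by
  unfold dcmp
  split_ifs
  · rfl
  · simp [hxy]

lemma ag_cmp {X : Finset α} {r t : ℕ} {F : Finset (Finset α)} (y : α)
    (h : ∀ f : Fin r → Finset α, (∀ i, f i ∈ F) → t ≤ (agr X f).card)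
    (f : Fin r → Finset α) (hf : ∀ i, f i ∈ F.image (dcmp y F)) : t ≤ (agr X f).card := by
  have hf2 := fun k => mem_cmp (hf k)
  by_cases hall : ∀ k, f k ∈ F
  · exact h f hall
  push Not at hall
  obtain ⟨k0, hk0⟩ := hall
  let g : Fin r → Finset α := fun k =>
    if f k ∈ F then (f k).erase y else insert y (f k)
  have hg : ∀ k, g k ∈ F := by
    intro k
    simp only [g]
    rcases hf2 k with h1 | h1
    · rw [if_pos h1.1]
      exact h1.2
    · rw [if_neg h1.1]
      exact h1.2.2
  have hgx : ∀ x, x ≠ y → ∀ k, (x ∈ g k ↔ x ∈ f k) := by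
    intro x hx k
    simp only [g]
    split_ifs <;> simp [hx]
  refine (h g hg).trans (Finset.card_le_card ?_)
  intro x hx
  obtain ⟨hxX, hx⟩ := mem_agr.1 hx
  rw [mem_agr]
  refine ⟨hxX, ?_⟩
  by_cases hxy : x = y
  · right
    intro k hk
    have hkF : f k ∈ F := by
      rcases hf2 k with h1 | h1
      · exact h1.1
      · exact absurd (hxy ▸ hk) h1.2.1
    rcases hx with hx | hx
    · have := hx k
      simp [g, hkF, hxy] at this
    · have := hx k0
      simp [g, hk0, hxy] at this
  · simpa only [hgx x hxy] using hx

lemma af_two {X : Finset α} {t : ℕ} {F : Finset (Finset α)} (h : AF X 2 t F) (ht : 1 ≤ t) :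
    F.card + F.card ≤ 2 ^ X.card := by
  have hinj : Set.InjOn (fun A => X \ A) (F : Set (Finset α)) := by
    intro A hA B hB hAB
    have h1 := h.sub A hA
    have h2 := h.sub B hB
    simp only at hAB
    rw [← Finset.sdiff_sdiff_eq_self h1, hAB, Finset.sdiff_sdiff_eq_self h2]
  nth_rw 1 [← Finset.card_image_of_injOn hinj]
  rw [← Finset.card_powerset, ← Finset.card_union_of_disjoint]
  · apply Finset.card_le_card
    intro A hA
    simp only [Finset.mem_union, Finset.mem_image] at hA
    rw [Finset.mem_powerset]
    rcases hA with ⟨B, hB, rfl⟩ | hA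
    · exact Finset.sdiff_subset
    · exact h.sub A hA
  · rw [Finset.disjoint_left]
    intro A hA hA2
    simp only [Finset.mem_image] at hA
    obtain ⟨B, hB, rfl⟩ := hA
    have h1 := h.ag ![B, X \ B] (by intro i; fin_cases i <;> simpa)
    have h2 : agr X ![B, X \ B] = ∅ := by
      ext x
      rw [mem_agr]
      simp [Fin.forall_fin_two]
      tauto
    rw [h2] at h1
    simp at h1
    omega

lemma af_bound : ∀ (k : ℕ) (w : ℕ) (X : Finset α) (r t : ℕ) (F : Finset (Finset α)), X.card = k →
    ∑ A ∈ F, A.card = w → 2 ≤ r → 1 ≤ t → t + r + 1 ≤ 2 ^ r → AF X r t F →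
    (F.card : ℚ) * 2 ^ (r + t) ≤ (r + t + 1) * 2 ^ X.card := by
  intro k
  induction k using Nat.strong_induction_on with
  | _ k ihk =>
  intro w
  induction w using Nat.strong_induction_on with
  | _ w ihw =>
  intro X r t F hX hw hr ht htr h
  rcases hr.eq_or_lt with rfl | hr3
  · obtain rfl : t = 1 := by omega
    have h1 := af_two h le_rfl
    have h2 : (F.card : ℚ) + F.card ≤ 2 ^ X.card := by exact_mod_cast h1
    norm_num
    linarith
  have hr3 : 3 ≤ r := hr3
  by_cases hst : ∀ y ∈ X, ∀ A ∈ F, A.erase y ∈ F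
  · exact af_stable h hr ht htr hst
  push Not at hst
  obtain ⟨y, hy, A0, hA0, hA0F⟩ := hst
  have hcmp0 : dcmp y F A0 = A0.erase y := by
    unfold dcmp
    rw [if_neg hA0F]
  have hcard : (F.image (dcmp y F)).card = F.card := Finset.card_image_of_injOn (cmp_inj y F)
  have hsub : ∀ A ∈ F.image (dcmp y F), A ⊆ X := by
    intro A hA
    obtain ⟨B, hB, rfl⟩ := Finset.mem_image.1 hA
    unfold dcmp
    split_ifs
    · exact h.sub B hB
    · exact (Finset.erase_subset _ _).trans (h.sub B hB)
  have hn1 : ∀ x ∈ X, ∃ A ∈ F.image (dcmp y F), x ∉ A := by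
    intro x hx
    by_cases hxy : x = y
    · exact ⟨_, Finset.mem_image_of_mem _ hA0, by rw [hcmp0, hxy]; simp⟩
    · obtain ⟨A, hA, hxA⟩ := h.nt1 x hx
      exact ⟨_, Finset.mem_image_of_mem _ hA, by rwa [cmp_ne hxy]⟩
  have hn2 : ∀ x ∈ X, x ≠ y → ∃ A ∈ F.image (dcmp y F), x ∈ A := by
    intro x hx hxy
    obtain ⟨A, hA, hxA⟩ := h.nt2 x hx
    exact ⟨_, Finset.mem_image_of_mem _ hA, by rwa [cmp_ne hxy]⟩
  have hag := fun f hf => ag_cmp (X := X) (r := r) (t := t) y h.ag f hf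
  by_cases hex : ∃ A ∈ F.image (dcmp y F), y ∈ A
  · have hlt : ∑ A ∈ F.image (dcmp y F), A.card < w := by
      rw [← hw, Finset.sum_image (cmp_inj y F)]
      apply Finset.sum_lt_sum
      · intro A hA
        unfold dcmp
        split_ifs
        · exact le_rfl
        · exact Finset.card_le_card (Finset.erase_subset _ _)
      · refine ⟨A0, hA0, ?_⟩
        rw [hcmp0]
        apply Finset.card_erase_lt_of_mem
        by_contra h2
        rw [Finset.erase_eq_of_notMem h2] at hA0F
        exact hA0F hA0
    rw [← hcard]
    refine ihw _ hlt X r t _ hX rfl hr ht htr ⟨hsub, hn1, ?_, hag⟩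
    intro x hx
    by_cases hxy : x = y
    · rw [hxy]
      exact hex
    · exact hn2 x hx hxy
  · push Not at hex
    have hc : (X.erase y).card + 1 = X.card := Finset.card_erase_add_one hy
    have hs2 : ∀ A ∈ F.image (dcmp y F), A ⊆ X.erase y := by
      intro A hA x hx
      refine Finset.mem_erase.2 ⟨?_, hsub A hA hx⟩
      rintro rfl
      exact hex A hA hx
    have hm1 : ∀ x ∈ X.erase y, ∃ A ∈ F.image (dcmp y F), x ∉ A :=
      fun x hx => hn1 x (Finset.mem_of_mem_erase hx)
    have hm2 : ∀ x ∈ X.erase y, ∃ A ∈ F.image (dcmp y F), x ∈ A :=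
      fun x hx => hn2 x (Finset.mem_of_mem_erase hx) (Finset.ne_of_mem_erase hx)
    rw [← hcard, ← hc]
    rcases ht.eq_or_lt with rfl | ht2
    · obtain ⟨r, rfl⟩ : ∃ k, r = k + 1 := ⟨r - 1, by omega⟩
      have h2r : 2 * (r + 1) + 2 ≤ 2 ^ (r + 1) := by
        clear * - hr3
        have hr2 : 2 ≤ r := by omega
        induction r, hr2 using Nat.le_induction with
        | base => norm_num
        | succ r hr ih => have := ih (by omega); rw [pow_succ]; omega
      have hA : AF (X.erase y) r 1 (F.image (dcmp y F)) := by
        refine ⟨hs2, hm1, hm2, ?_⟩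
        intro g hg
        have hg2 : ∀ k, ∃ A ∈ F, dcmp y F A = g k := fun k => Finset.mem_image.1 (hg k)
        choose f hfF hfg using hg2
        by_contra hcon
        have hempty : agr (X.erase y) g = ∅ := by
          rw [← Finset.card_eq_zero]
          omega
        let k0 : Fin r := ⟨0, by omega⟩
        have hB : ∃ B ∈ F, ¬ (y ∈ B ↔ y ∈ f k0) := by
          by_cases h1 : y ∈ f k0
          · obtain ⟨B, hB, hyB⟩ := h.nt1 y hy
            exact ⟨B, hB, by tauto⟩
          · obtain ⟨B, hB, hyB⟩ := h.nt2 y hy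
            exact ⟨B, hB, by tauto⟩
        obtain ⟨B, hBF, hB⟩ := hB
        have h1 := h.ag (Fin.cons B f) (by
          intro i
          refine Fin.cases ?_ ?_ i
          · simpa using hBF
          · intro i
            simpa using hfF i)
        obtain ⟨x, hx⟩ := Finset.card_pos.1 h1
        obtain ⟨hxX, hx⟩ := mem_agr.1 hx
        simp only [Fin.forall_fin_succ, Fin.cons_zero, Fin.cons_succ] at hx
        by_cases hxy : x = y
        · subst hxy
          rcases hx with ⟨h2, h3⟩ | ⟨h2, h3⟩
          · exact hB ⟨fun _ => h3 k0, fun _ => h2⟩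
          · exact hB ⟨fun h => absurd h h2, fun h => absurd h (h3 k0)⟩
        · have : x ∈ agr (X.erase y) g := by
            rw [mem_agr]
            refine ⟨Finset.mem_erase.2 ⟨hxy, hxX⟩, ?_⟩
            simp only [← hfg, cmp_ne hxy]
            rcases hx with ⟨_, h3⟩ | ⟨_, h3⟩
            · exact Or.inl h3
            · exact Or.inr h3
          rw [hempty] at this
          simp at this
      have := ihk (X.erase y).card (by omega) _ (X.erase y) r 1 _ rfl rfl (by omega) le_rfl
        (by rw [pow_succ] at h2r; omega) hA
      rw [pow_succ 2 (X.erase y).card, pow_succ 2 (r + 1)]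
      have hp : (0 : ℚ) < 2 ^ (X.erase y).card := by positivity
      push_cast at this ⊢
      linarith
    · obtain ⟨t, rfl⟩ : ∃ k, t = k + 1 := ⟨t - 1, by omega⟩
      have hA : AF (X.erase y) r t (F.image (dcmp y F)) := by
        refine ⟨hs2, hm1, hm2, ?_⟩
        intro g hg
        have h1 := hag g hg
        have h2 : agr X g ⊆ insert y (agr (X.erase y) g) := by
          intro x hx
          rw [mem_agr] at hx
          rw [Finset.mem_insert, mem_agr, Finset.mem_erase]
          tauto
        have h3 := (Finset.card_le_card h2).trans (Finset.card_insert_le _ _)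
        omega
      have := ihk (X.erase y).card (by omega) _ (X.erase y) r t _ rfl rfl (by omega) (by omega)
        (by omega) hA
      rw [pow_succ 2 (X.erase y).card, ← add_assoc, pow_succ 2 (r + t)]
      have hp : (0 : ℚ) < 2 ^ (X.erase y).card := by positivity
      push_cast at this ⊢
      linarith

end Agree

theorem stmt0 (n r t : ℕ) (hrn : r < n) (hr : 2 ≤ r) (ht1 : 1 ≤ t)
    (ht : t ≤ 2 ^ r - r - 1) (F : Finset (Finset (Fin n)))
    (hnt : NonTrivialFamily n F) (hag : AgreeingFamily n r t F) :
    F.card ≤ (r + t + 1) * 2 ^ (n - r - t) := by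
  have h2r : r + 1 ≤ 2 ^ r := Nat.lt_two_pow_self
  have hAF : AF (Finset.univ : Finset (Fin n)) r t F :=
    ⟨fun A _ => Finset.subset_univ A, fun x _ => hnt.1 x, fun x _ => hnt.2 x,
      fun f hf => hag f hf⟩
  have h := af_bound n _ Finset.univ r t F (by simp) rfl hr ht1 (by omega) hAF
  rw [Finset.card_univ, Fintype.card_fin] at h
  have hN : F.card * 2 ^ (r + t) ≤ (r + t + 1) * 2 ^ n := by exact_mod_cast h
  have hle : 2 ^ n ≤ 2 ^ (n - r - t) * 2 ^ (r + t) := by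
    rw [← pow_add]
    exact Nat.pow_le_pow_right (by norm_num) (by omega)
  have h3 : F.card * 2 ^ (r + t) ≤ ((r + t + 1) * 2 ^ (n - r - t)) * 2 ^ (r + t) := by
    calc _ ≤ (r + t + 1) * 2 ^ n := hN
      _ ≤ (r + t + 1) * (2 ^ (n - r - t) * 2 ^ (r + t)) := Nat.mul_le_mul_left _ hle
      _ = _ := by ring
  exact Nat.le_of_mul_le_mul_right h3 (by positivity)
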